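/- arXiv:1702.00156 — 4 statements merged into one kernel-verified Lean document; each statement's English description precedes it below -/
import Mathlib

section
/- Any two finite connected simple graphs with no isolated vertices, each having at most 4 edges, whose multisets of vertex degrees coincide, are isomorphic. In other words, the sorted degree sequence is a perfect graph hash function (zero probability of collision) on connected graphlets with at most 4 edges. -/
namespace Graphlet

/-- The ordered pairs `i < j` of elements of `Fin n`. -/
def pairs (n : ℕ) : List (Fin n × Fin n) :=
  ((List.finRange n).product (List.finRange n)).filter fun p => p.1 < p.2

/-- Adjacency in the graph whose edges are the entries of `E`. -/
def Adj {n : ℕ} (E : List (Fin n × Fin n)) (i j : Fin n) : Prop :=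
  (i, j) ∈ E ∨ (j, i) ∈ E

instance {n : ℕ} (E : List (Fin n × Fin n)) (i j : Fin n) : Decidable (Adj E i j) :=
  inferInstanceAs (Decidable (_ ∨ _))

/-- The degree of a vertex in the graph with edge list `E`. -/
def deg {n : ℕ} (E : List (Fin n × Fin n)) (i : Fin n) : ℕ :=
  (Finset.univ.filter fun j => Adj E i j).card

/-- The degrees increase along `Fin n`, no vertex is isolated, and no edge is a component
unless there are only two vertices. -/
def IsGood {n : ℕ} (E : List (Fin n × Fin n)) : Prop :=
  (∀ i j : Fin n, i ≤ j → deg E i ≤ deg E j) ∧ (∀ i, ∃ j, Adj E i j) ∧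
    ∀ i j, Adj E i j → n ≤ 2 ∨ ∃ k, k ≠ i ∧ k ≠ j ∧ (Adj E i k ∨ Adj E j k)

instance {n : ℕ} (E : List (Fin n × Fin n)) : Decidable (IsGood E) :=
  inferInstanceAs (Decidable (_ ∧ _ ∧ _))

/-- The good edge lists with at most four edges. -/
def goodLists (n : ℕ) : List (List (Fin n × Fin n)) :=
  ((List.range 5).flatMap fun k => List.sublistsLen k (pairs n)).filter fun E => IsGood E

set_option maxRecDepth 100000 in
theorem exists_perm_of_mem_goodLists : ∀ n < 6, ∀ E ∈ goodLists n, ∀ F ∈ goodLists n,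
    (∀ i, deg E i = deg F i) →
      ∃ σ : Equiv.Perm (Fin n), ∀ i j, Adj F (σ i) (σ j) ↔ Adj E i j := by
  decide +kernel

open Classical in
/-- The list of edges of a graph on `Fin n`. -/
noncomputable def edgeList {n : ℕ} (G : SimpleGraph (Fin n)) : List (Fin n × Fin n) :=
  (pairs n).filter fun p => G.Adj p.1 p.2

theorem mem_edgeList {n : ℕ} (G : SimpleGraph (Fin n)) (p : Fin n × Fin n) :
    p ∈ edgeList G ↔ p.1 < p.2 ∧ G.Adj p.1 p.2 := by
  have hp : p ∈ (List.finRange n).product (List.finRange n) :=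
    List.mem_product.2 ⟨List.mem_finRange _, List.mem_finRange _⟩
  simp [edgeList, pairs, hp, and_comm]

theorem adj_edgeList {n : ℕ} (G : SimpleGraph (Fin n)) (i j : Fin n) :
    Adj (edgeList G) i j ↔ G.Adj i j := by
  simp only [Adj, mem_edgeList]
  constructor
  · rintro (h | h)
    exacts [h.2, h.2.symm]
  · intro h
    rcases lt_or_gt_of_ne h.ne with h' | h'
    exacts [.inl ⟨h', h⟩, .inr ⟨h', h.symm⟩]

theorem deg_edgeList {n : ℕ} (G : SimpleGraph (Fin n)) (i : Fin n) :
    deg (edgeList G) i = (G.neighborSet i).ncard := by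
  rw [deg, ← Set.ncard_coe_finset]
  congr 1
  ext j
  simp [adj_edgeList]

theorem length_edgeList_le {n : ℕ} (G : SimpleGraph (Fin n)) :
    (edgeList G).length ≤ G.edgeSet.ncard := by
  have hnd : (edgeList G).Nodup :=
    (((List.nodup_finRange n).product (List.nodup_finRange n)).filter _).filter _
  rw [← List.toFinset_card_of_nodup hnd, ← Set.ncard_coe_finset]
  refine Set.ncard_le_ncard_of_injOn (fun p => s(p.1, p.2)) ?_ ?_ (Set.toFinite _)
  · intro p hp
    exact ((mem_edgeList G p).1 (by simpa using hp)).2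
  · rintro ⟨a, b⟩ hp ⟨c, d⟩ hq h
    have hp := ((mem_edgeList G _).1 (by simpa using hp)).1
    have hq := ((mem_edgeList G _).1 (by simpa using hq)).1
    rcases Sym2.eq_iff.1 h with ⟨h₁, h₂⟩ | ⟨h₁, h₂⟩
    · exact Prod.ext h₁ h₂
    · simp only at h₁ h₂ hp hq
      subst h₁ h₂
      exact absurd hp hq.asymm

theorem exists_adj_of_connected {n : ℕ} {G : SimpleGraph (Fin n)} (hG : G.Connected)
    (hn : 2 < n) (i j : Fin n) : ∃ k, k ≠ i ∧ k ≠ j ∧ (G.Adj i k ∨ G.Adj j k) := by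
  obtain ⟨k, hk⟩ : ∃ k, k ∉ ({i, j} : Finset (Fin n)) := by
    by_contra! h
    have h₁ := Finset.card_le_card (fun k _ => h k : (Finset.univ : Finset (Fin n)) ⊆ {i, j})
    have h₂ := Finset.card_le_two (a := i) (b := j)
    simp only [Finset.card_univ, Fintype.card_fin] at h₁
    omega
  obtain ⟨p⟩ := hG.preconnected i k
  obtain ⟨d, -, hd, hd'⟩ := p.exists_boundary_dart {i, j} (by simp) (by simpa using hk)
  have hadj := d.adj
  simp only [Set.mem_insert_iff, Set.mem_singleton_iff, not_or] at hd hd'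
  refine ⟨d.snd, hd'.1, hd'.2, ?_⟩
  rcases hd with hd | hd
  · exact .inl (hd ▸ hadj)
  · exact .inr (hd ▸ hadj)

theorem edgeList_mem_goodLists {n : ℕ} {G : SimpleGraph (Fin n)} (hG : G.Connected)
    (hiso : ∀ v, ∃ u, G.Adj v u) (hcard : G.edgeSet.ncard ≤ 4)
    (hmono : Monotone fun i => (G.neighborSet i).ncard) : edgeList G ∈ goodLists n := by
  have hlen := (length_edgeList_le G).trans hcard
  simp only [goodLists, List.mem_filter, List.mem_flatMap, List.mem_range,
    List.mem_sublistsLen, decide_eq_true_eq]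
  refine ⟨⟨_, by omega, List.filter_sublist, rfl⟩, ?_, ?_, ?_⟩
  · intro i j hij
    simpa only [deg_edgeList] using hmono hij
  · simpa only [adj_edgeList] using hiso
  · intro i j _
    simp only [adj_edgeList]
    exact (le_or_gt n 2).imp_right fun hn => exists_adj_of_connected hG hn i j

theorem nonempty_iso_of_monotone {n : ℕ} {G H : SimpleGraph (Fin n)}
    (hG : G.Connected) (hH : H.Connected)
    (hGiso : ∀ v, ∃ u, G.Adj v u) (hHiso : ∀ v, ∃ u, H.Adj v u)
    (hGe : G.edgeSet.ncard ≤ 4) (hHe : H.edgeSet.ncard ≤ 4)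
    (hdeg : ∀ i, (G.neighborSet i).ncard = (H.neighborSet i).ncard)
    (hmono : Monotone fun i => (G.neighborSet i).ncard) : Nonempty (G ≃g H) := by
  have hn : n < 6 := by
    have h := hG.card_vert_le_card_edgeSet_add_one
    rw [Nat.card_fin, Nat.card_coe_set_eq] at h
    omega
  obtain ⟨σ, hσ⟩ := exists_perm_of_mem_goodLists n hn _
    (edgeList_mem_goodLists hG hGiso hGe hmono) _
    (edgeList_mem_goodLists hH hHiso hHe (by simpa only [hdeg] using hmono))
    (by simpa only [deg_edgeList] using hdeg)
  exact ⟨⟨σ, fun {i j} => by simpa only [adj_edgeList] using hσ i j⟩⟩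

theorem ncard_neighborSet_iso {V W : Type*} {G : SimpleGraph V} {H : SimpleGraph W}
    (f : G ≃g H) (v : V) : (G.neighborSet v).ncard = (H.neighborSet (f v)).ncard :=
  Nat.card_congr (f.mapNeighborSet v)

theorem ncard_edgeSet_iso {V W : Type*} {G : SimpleGraph V} {H : SimpleGraph W}
    (f : G ≃g H) : G.edgeSet.ncard = H.edgeSet.ncard :=
  Nat.card_congr f.mapEdgeSet

theorem forall_exists_adj_iso {V W : Type*} {G : SimpleGraph V} {H : SimpleGraph W}
    (f : G ≃g H) (h : ∀ w, ∃ u, H.Adj w u) (v : V) : ∃ u, G.Adj v u := by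
  obtain ⟨u, hu⟩ := h (f v)
  exact ⟨f.symm u, f.map_adj_iff.1 (by simpa using hu)⟩

theorem exists_equiv_monotone {V : Type*} [Fintype V] {n : ℕ} (hn : Fintype.card V = n)
    (f : V → ℕ) : ∃ g : Fin n ≃ V, Monotone (f ∘ g) :=
  let a := Fintype.equivFinOfCardEq hn
  ⟨(Tuple.sort (f ∘ a.symm)).trans a.symm, Tuple.monotone_sort (f ∘ a.symm)⟩

theorem eq_of_monotone_of_map_univ_eq {n : ℕ} {f g : Fin n → ℕ} (hf : Monotone f)
    (hg : Monotone g) (h : Finset.univ.val.map f = Finset.univ.val.map g) : f = g := by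
  rw [Fin.univ_val_map, Fin.univ_val_map, Multiset.coe_eq_coe] at h
  exact List.ofFn_injective (h.eq_of_pairwise' hf.sortedLE_ofFn.pairwise hg.sortedLE_ofFn.pairwise)

end Graphlet

open Graphlet in
/-- Any two finite connected simple graphs with no isolated vertices, each having at
most 4 edges, whose multisets of vertex degrees coincide, are isomorphic.  (The degree
of a vertex is the cardinality of its neighbor set; the degree multiset is the
multiset of degrees over all vertices.) -/
theorem degree_multiset_perfect_hash_up_to_four_edges
    {V W : Type*} [Fintype V] [Fintype W]
    (G : SimpleGraph V) (H : SimpleGraph W)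
    (hGconn : G.Connected) (hHconn : H.Connected)
    (hGiso : ∀ v, ∃ u, G.Adj v u) (hHiso : ∀ w, ∃ u, H.Adj w u)
    (hGe : G.edgeSet.ncard ≤ 4) (hHe : H.edgeSet.ncard ≤ 4)
    (hdeg : (Finset.univ.val.map fun v : V => (G.neighborSet v).ncard)
          = (Finset.univ.val.map fun w : W => (H.neighborSet w).ncard)) :
    Nonempty (G ≃g H) := by
  have hcard : Fintype.card V = Fintype.card W := by
    simpa using congrArg Multiset.card hdeg
  obtain ⟨g, hg⟩ := exists_equiv_monotone rfl fun v => (G.neighborSet v).ncard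
  obtain ⟨h, hh⟩ := exists_equiv_monotone hcard.symm fun w => (H.neighborSet w).ncard
  rw [← Multiset.map_univ_val_equiv g, ← Multiset.map_univ_val_equiv h, Multiset.map_map,
    Multiset.map_map] at hdeg
  have hgh := eq_of_monotone_of_map_univ_eq hg hh hdeg
  let eG := SimpleGraph.Iso.comap g G
  let eH := SimpleGraph.Iso.comap h H
  obtain ⟨f⟩ := nonempty_iso_of_monotone (eG.connected_iff.2 hGconn) (eH.connected_iff.2 hHconn)
    (forall_exists_adj_iso eG hGiso) (forall_exists_adj_iso eH hHiso)
    ((ncard_edgeSet_iso eG).trans_le hGe) ((ncard_edgeSet_iso eH).trans_le hHe)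
    (fun i => by
      rw [ncard_neighborSet_iso eG, ncard_neighborSet_iso eH]
      exact congrFun hgh i)
    (by simp only [ncard_neighborSet_iso eG]; exact hg)
  exact ⟨eG.symm.trans (f.trans eH)⟩
end

section
/- Among the 12 isomorphism classes of finite connected simple graphs with no isolated vertices having exactly 5 edges, there are exactly 2 unordered pairs of distinct (non-isomorphic) classes whose multisets of vertex degrees coincide. In particular, there exist two non-isomorphic connected simple graphs with 5 edges having the same sorted degree sequence, so the degree hash function collides on graphlets with 5 edges. -/
/-- A graphlet with `k` edges: a finite connected simple graph with no isolated
vertices whose edge set has cardinality `k` (vertex set taken as `Fin n` for some `n`). -/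
def Graphlet (k : ℕ) :=
  { G : Σ n : ℕ, SimpleGraph (Fin n) //
      G.2.Connected ∧ (∀ v, ∃ w, G.2.Adj v w) ∧ G.2.edgeSet.ncard = k }

/-- Two graphlets are related iff they are isomorphic as simple graphs. -/
def graphletIso {k : ℕ} (G H : Graphlet k) : Prop :=
  Nonempty (G.1.2 ≃g H.1.2)

/-- Isomorphism classes of graphlets with `k` edges. -/
def GraphletClass (k : ℕ) := Quot (@graphletIso k)

/-- The degree multiset (sorted degree sequence) of a graphlet: the multiset of the
degrees of its vertices. -/
noncomputable def degMultiset {k : ℕ} (G : Graphlet k) : Multiset ℕ :=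
  Finset.univ.val.map fun v => (G.1.2.neighborSet v).ncard

/-- Two isomorphism classes have coinciding degree multisets. -/
def sameDegClass {k : ℕ} (c c' : GraphletClass k) : Prop :=
  ∃ G H : Graphlet k, Quot.mk graphletIso G = c ∧ Quot.mk graphletIso H = c' ∧
    degMultiset G = degMultiset H

/-- The simple graph on `Fin n` whose edges are the pairs of distinct numbers below `n` occurring
in the list `L`. -/
def listGraph (n : ℕ) (L : List (ℕ × ℕ)) : SimpleGraph (Fin n) where
  Adj a b := a ≠ b ∧ ((a.1, b.1) ∈ L ∨ (b.1, a.1) ∈ L)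
  symm := ⟨fun _ _ h => ⟨h.1.symm, h.2.symm⟩⟩
  loopless := ⟨fun _ h => h.1 rfl⟩

instance (n : ℕ) (L : List (ℕ × ℕ)) : DecidableRel (listGraph n L).Adj := fun a b =>
  inferInstanceAs (Decidable (a ≠ b ∧ ((a.1, b.1) ∈ L ∨ (b.1, a.1) ∈ L)))

/-- Increasing pairs of numbers below `n`. -/
def increasingPairs (n : ℕ) : List (ℕ × ℕ) :=
  (List.range n).flatMap fun b => (List.range b).map fun a => (a, b)

theorem mem_increasingPairs {n a b : ℕ} : (a, b) ∈ increasingPairs n ↔ a < b ∧ b < n := by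
  simp [increasingPairs]
  tauto

theorem nodup_increasingPairs (n : ℕ) : (increasingPairs n).Nodup := by
  refine List.nodup_flatMap.2 ⟨fun b _ => ?_, ?_⟩
  · exact List.nodup_range.map fun x y h => congrArg Prod.fst h
  · refine List.nodup_range.imp fun {b c} hbc => ?_
    rw [Function.onFun, List.disjoint_left]
    rintro ⟨x, y⟩ hx hy
    simp only [List.mem_map, List.mem_range, Prod.mk.injEq] at hx hy
    obtain ⟨_, _, _, rfl⟩ := hx
    obtain ⟨_, _, _, rfl⟩ := hy
    exact hbc rfl

/-- Every vertex but the first one has an earlier neighbour. -/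
def HasEarlierNeighbors {n : ℕ} (G : SimpleGraph (Fin (n + 1))) : Prop :=
  ∀ i : Fin n, ∃ j : Fin (n + 1), j < i.succ ∧ G.Adj j i.succ

theorem HasEarlierNeighbors.connected {n : ℕ} {G : SimpleGraph (Fin (n + 1))}
    (h : HasEarlierNeighbors G) : G.Connected := by
  have key : ∀ i, G.Reachable 0 i := by
    intro i
    induction i using WellFoundedLT.induction with
    | _ i ih =>
      cases i using Fin.cases with
      | zero => exact .refl _
      | succ i =>
        obtain ⟨j, hj, hadj⟩ := h i
        exact (ih j hj).trans hadj.reachable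
  exact ⟨fun a b => (key a).symm.trans (key b)⟩

/-- Ordering the vertices of a connected graph by their distance from a root. -/
theorem SimpleGraph.Connected.exists_iso_hasEarlierNeighbors {n : ℕ}
    {G : SimpleGraph (Fin (n + 1))} (hG : G.Connected) :
    ∃ H : SimpleGraph (Fin (n + 1)), Nonempty (G ≃g H) ∧ HasEarlierNeighbors H := by
  set σ := Tuple.sort (G.dist 0) with hσ
  have hmono : Monotone (G.dist 0 ∘ σ) := Tuple.monotone_sort _
  refine ⟨G.comap σ, ⟨(SimpleGraph.Iso.comap σ G).symm⟩, fun i => ?_⟩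
  have h0 : σ 0 = 0 := by
    have := hmono (Fin.zero_le (σ.symm 0))
    simp only [Function.comp, Equiv.apply_symm_apply, SimpleGraph.dist_self, Nat.le_zero] at this
    exact ((hG.dist_eq_zero_iff).1 this).symm
  have hi : σ i.succ ≠ 0 := fun h => Fin.succ_ne_zero i (σ.injective (h.trans h0.symm))
  have hmono' : ∀ v, i.succ ≤ σ.symm v → G.dist 0 (σ i.succ) ≤ G.dist 0 v := fun v hle => by
    simpa only [Function.comp, Equiv.apply_symm_apply] using hmono hle
  obtain ⟨w, hw⟩ := hG.exists_walk_length_eq_dist (σ i.succ) 0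
  simp only [SimpleGraph.comap_adj]
  generalize σ i.succ = u at hi w hw hmono' ⊢
  cases w with
  | nil => exact absurd rfl hi
  | @cons _ v _ hadj q =>
    refine ⟨σ.symm v, ?_, by simpa using hadj.symm⟩
    by_contra! hle
    have h1 := hmono' v hle
    have h2 := SimpleGraph.dist_le q
    rw [SimpleGraph.Walk.length_cons, SimpleGraph.dist_comm] at hw
    rw [SimpleGraph.dist_comm] at h2
    omega

theorem exists_eq_listGraph {n : ℕ} (G : SimpleGraph (Fin n)) :
    ∃ L ∈ (increasingPairs n).sublistsLen G.edgeSet.ncard, G = listGraph n L := by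
  classical
  set p : ℕ × ℕ → Prop := fun e => ∃ a b : Fin n, G.Adj a b ∧ e = (a.1, b.1) with hp
  set L := (increasingPairs n).filter (fun e => p e) with hL
  have hmem : ∀ a b : Fin n, (a.1, b.1) ∈ L ↔ a < b ∧ G.Adj a b := by
    intro a b
    simp only [hL, List.mem_filter, mem_increasingPairs, hp, decide_eq_true_eq, Prod.mk.injEq]
    constructor
    · rintro ⟨⟨h, -⟩, a', b', hadj, ha, hb⟩
      rw [Fin.ext ha, Fin.ext hb]
      exact ⟨by omega, hadj⟩
    · exact fun h => ⟨⟨h.1, b.2⟩, a, b, h.2, rfl, rfl⟩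
  have hadj : G = listGraph n L := by
    ext a b
    simp only [listGraph, hmem, G.adj_comm b a]
    constructor
    · intro h
      rcases lt_or_gt_of_ne h.ne with h' | h'
      · exact ⟨h.ne, .inl ⟨h', h⟩⟩
      · exact ⟨h.ne, .inr ⟨h', h⟩⟩
    · rintro ⟨-, h | h⟩ <;> exact h.2
  refine ⟨L, List.mem_sublistsLen.2 ⟨List.filter_sublist, ?_⟩, hadj⟩
  rw [← List.toFinset_card_of_nodup ((nodup_increasingPairs n).filter _), ← Set.ncard_coe_finset]
  refine (Set.ncard_congr (fun e _ => (e.inf.1, e.sup.1)) ?_ ?_ ?_).symm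
  · intro e
    induction e with | _ a b
    intro h
    have h : G.Adj a b := h
    rw [Finset.mem_coe, List.mem_toFinset, hmem]
    rcases lt_or_gt_of_ne h.ne with h' | h'
    · simpa [h'.le, h'] using h
    · simpa [h'.le, h'] using h.symm
  · intro e f _ _ h
    simp only [Prod.mk.injEq, Fin.val_inj] at h
    exact Sym2.inf_eq_inf_and_sup_eq_sup.1 h
  · rintro ⟨a, b⟩ h
    rw [Finset.mem_coe, List.mem_toFinset] at h
    have h' := mem_increasingPairs.1 (List.mem_of_mem_filter h)
    lift a to Fin n using h'.1.trans h'.2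
    lift b to Fin n using h'.2
    exact ⟨s(a, b), ((hmem a b).1 h).2, by simp [((hmem a b).1 h).1.le]⟩

/-- The degree multiset of `listGraph n L`. -/
def listDegrees (n : ℕ) (L : List (ℕ × ℕ)) : Multiset ℕ :=
  Finset.univ.val.map fun v : Fin n => (Finset.univ.filter ((listGraph n L).Adj v)).card

/-- The relabelling of the vertices in the order given by a list. -/
def relabel (n : ℕ) (s : List ℕ) (i : Fin (n + 1)) : Fin (n + 1) := Fin.ofNat (n + 1) (s.getD i 0)

/-- Edge lists representing the connected graphs with five edges on `n + 1` vertices. -/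
def modelLists : ℕ → List (List (ℕ × ℕ))
  | 3 => [[(0, 1), (0, 2), (0, 3), (1, 2), (1, 3)]]
  | 4 =>
    [[(0, 1), (1, 2), (2, 3), (0, 3), (0, 4)],
     [(0, 1), (0, 2), (1, 2), (0, 3), (3, 4)],
     [(0, 1), (1, 2), (2, 3), (3, 4), (0, 4)],
     [(0, 1), (0, 2), (1, 2), (0, 3), (0, 4)],
     [(0, 1), (0, 2), (1, 2), (0, 3), (1, 4)]]
  | 5 =>
    [[(0, 1), (0, 2), (0, 3), (3, 4), (4, 5)],
     [(0, 1), (0, 2), (0, 3), (2, 4), (3, 5)],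
     [(0, 1), (1, 2), (2, 3), (3, 4), (4, 5)],
     [(0, 1), (0, 2), (0, 3), (0, 4), (0, 5)],
     [(0, 1), (0, 2), (0, 3), (0, 4), (4, 5)],
     [(0, 1), (0, 2), (0, 3), (1, 4), (1, 5)]]
  | _ => []

/-- Some list of vertices is a certificate that the two list graphs are isomorphic. The two
leading conditions are redundant and only speed up the search. -/
def IsoCertified (n : ℕ) (L M : List (ℕ × ℕ)) : Prop :=
  listDegrees (n + 1) L = listDegrees (n + 1) M ∧
  ∃ s ∈ (List.range (n + 1)).permutations',
    (∀ e ∈ L, (s.getD e.1 0, s.getD e.2 0) ∈ M ∨ (s.getD e.2 0, s.getD e.1 0) ∈ M) ∧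
    (∀ i j, relabel n s i = relabel n s j → i = j) ∧
    ∀ i j, (listGraph (n + 1) M).Adj (relabel n s i) (relabel n s j) ↔
      (listGraph (n + 1) L).Adj i j

theorem IsoCertified.nonempty_iso {n : ℕ} {L M : List (ℕ × ℕ)} (h : IsoCertified n L M) :
    Nonempty (listGraph (n + 1) L ≃g listGraph (n + 1) M) := by
  obtain ⟨-, s, -, -, hinj, hadj⟩ := h
  exact ⟨⟨Equiv.ofBijective (relabel n s) (Finite.injective_iff_bijective.1 hinj), hadj _ _⟩⟩

instance (n : ℕ) (L M : List (ℕ × ℕ)) : Decidable (IsoCertified n L M) := by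
  unfold IsoCertified; infer_instance

instance {n : ℕ} (L : List (ℕ × ℕ)) : Decidable (HasEarlierNeighbors (listGraph (n + 1) L)) := by
  unfold HasEarlierNeighbors; infer_instance

theorem HasEarlierNeighbors.mem_map_snd {n : ℕ} {L : List (ℕ × ℕ)}
    (h : HasEarlierNeighbors (listGraph (n + 1) L)) (hL : L ⊆ increasingPairs (n + 1)) :
    ∀ i ∈ List.range n, i + 1 ∈ L.map Prod.snd := by
  intro i hi
  obtain ⟨j, hj, -, hmem | hmem⟩ := h ⟨i, List.mem_range.1 hi⟩
  · exact List.mem_map_of_mem hmem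
  · exact absurd (mem_increasingPairs.1 (hL hmem)).1 (not_lt_of_gt hj)

theorem isoCertified_modelLists : ∀ n ∈ [3, 4, 5],
    ∀ L ∈ (increasingPairs (n + 1)).sublistsLen 5, (∀ i ∈ List.range n, i + 1 ∈ L.map Prod.snd) →
      ∃ M ∈ modelLists n, IsoCertified n L M := by
  decide +kernel

/-- Representatives of the connected graphs with five edges, as pairs of the number of vertices
other than the first one and the edge list. -/
def models : List (ℕ × List (ℕ × ℕ)) := [3, 4, 5].flatMap fun n => (modelLists n).map (n, ·)

theorem exists_iso_model (G : Graphlet 5) :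
    ∃ x ∈ models, Nonempty (G.1.2 ≃g listGraph (x.1 + 1) x.2) := by
  obtain ⟨⟨m, G⟩, hconn, -, hcard⟩ := G
  dsimp only at hconn hcard ⊢
  obtain _ | n := m
  · exact hconn.nonempty.some.elim0
  obtain ⟨H, ⟨e⟩, hH⟩ := hconn.exists_iso_hasEarlierNeighbors
  have hcardH : H.edgeSet.ncard = 5 := by
    rw [← hcard]; exact (Nat.card_congr e.mapEdgeSet).symm
  have hle : n ≤ 5 := by
    have := hH.connected.card_vert_le_card_edgeSet_add_one
    rw [Nat.card_fin] at this
    have h' : Nat.card H.edgeSet = 5 := hcardH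
    omega
  obtain ⟨L, hL, rfl⟩ := exists_eq_listGraph H
  rw [hcardH] at hL
  have hn : n ∈ [3, 4, 5] := by
    have h5 := (List.mem_sublistsLen.1 hL)
    have hlen := h5.1.length_le
    rw [h5.2] at hlen
    interval_cases n <;> first | decide | exact absurd hlen (by decide)
  obtain ⟨M, hM, hiso⟩ := isoCertified_modelLists n hn L hL
    (hH.mem_map_snd (List.mem_sublistsLen.1 hL).1.subset)
  refine ⟨(n, M), List.mem_flatMap.2 ⟨n, hn, List.mem_map_of_mem hM⟩, ?_⟩
  exact hiso.nonempty_iso.map fun f => e.trans f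

theorem hasEarlierNeighbors_model :
    ∀ x ∈ models, HasEarlierNeighbors (listGraph (x.1 + 1) x.2) := by
  decide +kernel

theorem exists_adj_model :
    ∀ x ∈ models, ∀ v, ∃ w, (listGraph (x.1 + 1) x.2).Adj v w := by
  decide +kernel

theorem card_edgeFinset_model :
    ∀ x ∈ models, (listGraph (x.1 + 1) x.2).edgeFinset.card = 5 := by
  decide +kernel

/-- The graphlet given by a model. -/
def modelGraphlet (x : {x // x ∈ models}) : Graphlet 5 :=
  ⟨⟨x.1.1 + 1, listGraph (x.1.1 + 1) x.1.2⟩, (hasEarlierNeighbors_model x x.2).connected,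
    exists_adj_model x x.2, by
      rw [← card_edgeFinset_model x x.2, ← Set.ncard_coe_finset, SimpleGraph.coe_edgeFinset]⟩

theorem ncard_neighborSet_eq_card_filter {n : ℕ} (G : SimpleGraph (Fin n)) [DecidableRel G.Adj]
    (v : Fin n) : (G.neighborSet v).ncard = (Finset.univ.filter (G.Adj v)).card := by
  rw [← Set.ncard_coe_finset]
  congr 1
  ext w
  simp

theorem degMultiset_modelGraphlet (x : {x // x ∈ models}) :
    degMultiset (modelGraphlet x) = listDegrees (x.1.1 + 1) x.1.2 :=
  Multiset.map_congr rfl fun v _ =>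
    ncard_neighborSet_eq_card_filter (listGraph (x.1.1 + 1) x.1.2) v

theorem graphletIso_equivalence (k : ℕ) : Equivalence (@graphletIso k) :=
  ⟨fun _ => ⟨.refl⟩, fun ⟨e⟩ => ⟨e.symm⟩, fun ⟨e⟩ ⟨f⟩ => ⟨e.trans f⟩⟩

theorem graphletIso.degMultiset_eq {k : ℕ} {G H : Graphlet k} (h : graphletIso G H) :
    degMultiset G = degMultiset H := by
  obtain ⟨e⟩ := h
  have hmap : (Finset.univ : Finset (Fin H.1.1)).val = Finset.univ.val.map e.toEquiv := by
    rw [← Finset.map_univ_equiv e.toEquiv]; rfl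
  unfold degMultiset
  rw [hmap, Multiset.map_map]
  exact Multiset.map_congr rfl fun v _ => Nat.card_congr (e.mapNeighborSet v)

/-- The degree multiset of an isomorphism class. -/
noncomputable def GraphletClass.degMultiset {k : ℕ} : GraphletClass k → Multiset ℕ :=
  Quot.lift _root_.degMultiset fun _ _ h => h.degMultiset_eq

theorem sameDegClass_iff {k : ℕ} {c c' : GraphletClass k} :
    sameDegClass c c' ↔ c.degMultiset = c'.degMultiset := by
  constructor
  · rintro ⟨G, H, rfl, rfl, h⟩
    exact h
  · induction c using Quot.ind with | _ G
    induction c' using Quot.ind with | _ H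
    exact fun h => ⟨G, H, rfl, rfl, h⟩

theorem sameDegClass_pair_iff {k : ℕ} {a b : GraphletClass k} :
    (∀ c c', s(a, b) = s(c, c') → sameDegClass c c') ↔ a.degMultiset = b.degMultiset := by
  simp only [sameDegClass_iff]
  constructor
  · exact fun h => h a b rfl
  · intro h c c' hc
    obtain ⟨rfl, rfl⟩ | ⟨rfl, rfl⟩ := Sym2.eq_iff.1 hc
    exacts [h, h.symm]

theorem GraphletClass.mk_eq_mk_iff {k : ℕ} {G H : Graphlet k} :
    (Quot.mk graphletIso G : GraphletClass k) = Quot.mk graphletIso H ↔ graphletIso G H := by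
  rw [Quot.eq, (graphletIso_equivalence k).eqvGen_iff]

/-- The graph has two vertices with the same neighbours. -/
def HasTwins {V : Type*} (G : SimpleGraph V) : Prop :=
  ∃ a b, a ≠ b ∧ ∀ c, G.Adj a c ↔ G.Adj b c

theorem HasTwins.of_iso {V W : Type*} {G : SimpleGraph V} {H : SimpleGraph W} (e : G ≃g H)
    (h : HasTwins G) : HasTwins H := by
  obtain ⟨a, b, hab, h⟩ := h
  refine ⟨e a, e b, e.injective.ne hab, fun c => ?_⟩
  obtain ⟨c, rfl⟩ := e.surjective c
  simpa only [e.map_adj_iff] using h c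

instance (n : ℕ) (L : List (ℕ × ℕ)) : Decidable (HasTwins (listGraph n L)) := by
  unfold HasTwins; infer_instance

/-- The square with a pendant edge. -/
def banner : {x // x ∈ models} := ⟨(4, [(0, 1), (1, 2), (2, 3), (0, 3), (0, 4)]), by decide⟩

/-- The triangle with a pendant path of length two. -/
def lasso : {x // x ∈ models} := ⟨(4, [(0, 1), (0, 2), (1, 2), (0, 3), (3, 4)]), by decide⟩

/-- The spider with legs of lengths one, one and three. -/
def longSpider : {x // x ∈ models} :=
  ⟨(5, [(0, 1), (0, 2), (0, 3), (3, 4), (4, 5)]), by decide⟩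

/-- The spider with legs of lengths one, two and two. -/
def shortSpider : {x // x ∈ models} :=
  ⟨(5, [(0, 1), (0, 2), (0, 3), (2, 4), (3, 5)]), by decide⟩

theorem not_graphletIso_banner_lasso :
    ¬ graphletIso (modelGraphlet banner) (modelGraphlet lasso) := by
  rintro ⟨e⟩
  have hb : HasTwins (listGraph (banner.1.1 + 1) banner.1.2) := by decide +kernel
  have hl : ¬ HasTwins (listGraph (lasso.1.1 + 1) lasso.1.2) := by decide +kernel
  exact hl (hb.of_iso e)

theorem not_graphletIso_longSpider_shortSpider :
    ¬ graphletIso (modelGraphlet longSpider) (modelGraphlet shortSpider) := by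
  rintro ⟨e⟩
  have hl : HasTwins (listGraph (longSpider.1.1 + 1) longSpider.1.2) := by decide +kernel
  have hs : ¬ HasTwins (listGraph (shortSpider.1.1 + 1) shortSpider.1.2) := by decide +kernel
  exact hs (hl.of_iso e)

/-- The isomorphism class of a model. -/
def modelClass (x : {x // x ∈ models}) : GraphletClass 5 := Quot.mk _ (modelGraphlet x)

theorem degMultiset_modelClass (x : {x // x ∈ models}) :
    (modelClass x).degMultiset = listDegrees (x.1.1 + 1) x.1.2 :=
  degMultiset_modelGraphlet x

theorem modelClass_surjective : Function.Surjective modelClass := by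
  intro c
  induction c using Quot.ind with | _ G
  obtain ⟨x, hx, ⟨e⟩⟩ := exists_iso_model G
  exact ⟨⟨x, hx⟩, Quot.sound ⟨e.symm⟩⟩

theorem eq_or_collision_of_listDegrees_eq : ∀ x ∈ models, ∀ y ∈ models,
    listDegrees (x.1 + 1) x.2 = listDegrees (y.1 + 1) y.2 →
      x = y ∨ s(x, y) = s(banner.1, lasso.1) ∨ s(x, y) = s(longSpider.1, shortSpider.1) := by
  decide +kernel

theorem listDegrees_banner :
    listDegrees (banner.1.1 + 1) banner.1.2 = listDegrees (lasso.1.1 + 1) lasso.1.2 := by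
  decide +kernel

theorem listDegrees_longSpider :
    listDegrees (longSpider.1.1 + 1) longSpider.1.2 =
      listDegrees (shortSpider.1.1 + 1) shortSpider.1.2 := by
  decide +kernel

theorem collisions_eq :
    {p : Sym2 (GraphletClass 5) | ¬ p.IsDiag ∧ ∀ c c', p = s(c, c') → sameDegClass c c'} =
      {s(modelClass banner, modelClass lasso),
        s(modelClass longSpider, modelClass shortSpider)} := by
  ext p
  induction p with | _ a b
  rw [Set.mem_ofPred_eq, sameDegClass_pair_iff, Sym2.mk_isDiag_iff]
  constructor
  · rintro ⟨hne, hdeg⟩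
    obtain ⟨x, rfl⟩ := modelClass_surjective a
    obtain ⟨y, rfl⟩ := modelClass_surjective b
    rw [degMultiset_modelClass, degMultiset_modelClass] at hdeg
    have lift_pair {u v : {x // x ∈ models}} (h : s(x.1, y.1) = s(u.1, v.1)) :
        s(modelClass x, modelClass y) = s(modelClass u, modelClass v) :=
      congrArg (Sym2.map modelClass)
        (Sym2.map.injective Subtype.val_injective (a₁ := s(x, y)) (a₂ := s(u, v)) h)
    rcases eq_or_collision_of_listDegrees_eq x x.2 y y.2 hdeg with h | h | h
    · exact absurd (congrArg modelClass (Subtype.ext h)) hne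
    · exact .inl (lift_pair h)
    · exact .inr (lift_pair h)
  · have key {x y : {x // x ∈ models}} (hd : listDegrees (x.1.1 + 1) x.1.2 =
        listDegrees (y.1.1 + 1) y.1.2) (hxy : ¬ graphletIso (modelGraphlet x) (modelGraphlet y))
        (h : s(a, b) = s(modelClass x, modelClass y)) :
        a ≠ b ∧ a.degMultiset = b.degMultiset := by
      rw [← degMultiset_modelClass, ← degMultiset_modelClass] at hd
      have hne : modelClass x ≠ modelClass y := fun h => hxy (GraphletClass.mk_eq_mk_iff.1 h)
      obtain ⟨rfl, rfl⟩ | ⟨rfl, rfl⟩ := Sym2.eq_iff.1 h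
      exacts [⟨hne, hd⟩, ⟨hne.symm, hd.symm⟩]
    rintro (h | h)
    · exact key listDegrees_banner not_graphletIso_banner_lasso h
    · exact key listDegrees_longSpider not_graphletIso_longSpider_shortSpider h

/-- Among the 12 isomorphism classes of connected simple graphs (without isolated
vertices) with exactly 5 edges, there are exactly 2 unordered pairs of distinct
classes whose degree multisets coincide; in particular there exist two
non-isomorphic such graphs with the same degree multiset. -/
theorem degree_collisions_five_edges :
    Nat.card {p : Sym2 (GraphletClass 5) //
        ¬ p.IsDiag ∧ ∀ c c', p = s(c, c') → sameDegClass c c'} = 2 ∧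
    ∃ G H : Graphlet 5, ¬ graphletIso G H ∧ degMultiset G = degMultiset H := by
  refine ⟨?_, modelGraphlet banner, modelGraphlet lasso, not_graphletIso_banner_lasso, ?_⟩
  · refine (congrArg Set.ncard collisions_eq).trans (Set.ncard_pair fun h => ?_)
    have hne : listDegrees (banner.1.1 + 1) banner.1.2 ≠
        listDegrees (longSpider.1.1 + 1) longSpider.1.2 := by decide +kernel
    have hne' : listDegrees (banner.1.1 + 1) banner.1.2 ≠
        listDegrees (shortSpider.1.1 + 1) shortSpider.1.2 := by decide +kernel
    simp only [← degMultiset_modelClass] at hne hne'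
    obtain ⟨h, -⟩ | ⟨h, -⟩ := Sym2.eq_iff.1 h
    exacts [hne (congrArg _ h), hne' (congrArg _ h)]
  · rw [degMultiset_modelGraphlet, degMultiset_modelGraphlet, listDegrees_banner]
end

section
/- The number of isomorphism classes of finite connected simple graphs with no isolated vertices having exactly 7 edges is 79. -/
/-!
# Connected graphs with seven edges

Finite graphs are coded by natural numbers, and the connected graphs with `k + 1` edges are
generated from those with `k` edges, by joining two vertices or by hanging a new vertex on an old
one. A graph is dropped when an explicit isomorphism to an already listed one is found; a
polynomial invariant shows that the graphs remaining for `k = 7` are pairwise non-isomorphic.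
-/

namespace SimpleGraph

section Invariant

variable {V W : Type*} [Fintype V] [Fintype W]

open Classical in
/-- One plus the number of common neighbours of `v` and `w`. -/
noncomputable def pairWeight (G : SimpleGraph V) (v w : V) : ℕ :=
  1 + ∑ u, if G.Adj v u ∧ G.Adj w u then 1 else 0

open Classical in
/-- An isomorphism invariant which separates the connected graphs with at most seven edges. -/
noncomputable def weightInvariant (G : SimpleGraph V) : ℕ :=
  ∑ v, (∑ w, if G.Adj v w then
    G.pairWeight v w * (∑ u, if G.Adj w u then G.pairWeight w u else 0) ^ 2 else 0) ^ 2

theorem Iso.pairWeight_eq {G : SimpleGraph V} {H : SimpleGraph W} (φ : G ≃g H) (v w : V) :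
    H.pairWeight (φ.toEquiv v) (φ.toEquiv w) = G.pairWeight v w := by
  classical
  have hφ (x y) : H.Adj (φ.toEquiv x) (φ.toEquiv y) ↔ G.Adj x y := φ.map_rel_iff
  simp only [pairWeight, ← φ.toEquiv.sum_comp, hφ]

theorem Iso.weightInvariant_eq {G : SimpleGraph V} {H : SimpleGraph W} (φ : G ≃g H) :
    H.weightInvariant = G.weightInvariant := by
  classical
  have hφ (x y) : H.Adj (φ.toEquiv x) (φ.toEquiv y) ↔ G.Adj x y := φ.map_rel_iff
  simp only [weightInvariant, ← φ.toEquiv.sum_comp, hφ, φ.pairWeight_eq]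

end Invariant

theorem Connected.of_hom_of_adj {V W : Type*} {G : SimpleGraph V} {H : SimpleGraph W}
    (hH : H.Connected) (f : H →g G) {v : V} {x : W} (hv : G.Adj v (f x))
    (hf : ∀ y, y ≠ v → y ∈ Set.range f) : G.Connected := by
  refine (connected_iff_exists_forall_reachable G).2 ⟨f x, fun y => ?_⟩
  by_cases hy : y = v
  · exact hy ▸ hv.symm.reachable
  · obtain ⟨z, rfl⟩ := hf y hy
    exact (hH.preconnected x z).map f

/-- A connected graph with an edge has a non-bridge or a leaf. -/
theorem Connected.exists_deleteEdges_or_induce {V : Type*} [Finite V] {G : SimpleGraph V}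
    (hG : G.Connected) {k : ℕ} (hk : G.edgeSet.ncard = k + 1) :
    (∃ v w, G.Adj v w ∧ (G.deleteEdges {s(v, w)}).Connected ∧
      (G.deleteEdges {s(v, w)}).edgeSet.ncard = k) ∨
    ∃ v w, G.Adj v w ∧ (∀ x, G.Adj v x → x = w) ∧ (G.induce {v}ᶜ).Connected ∧
      (G.induce {v}ᶜ).edgeSet.ncard = k := by
  classical
  have := Fintype.ofFinite V
  have hne : G ≠ ⊥ := by
    rintro rfl
    simp at hk
  have : Nontrivial V := by
    obtain ⟨a, b, hab⟩ := ne_bot_iff_exists_adj.1 hne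
    exact ⟨a, b, hab.ne⟩
  obtain ⟨v, hv⟩ := hG.exists_connected_induce_compl_singleton_of_finite_nontrivial
  obtain ⟨w, hw⟩ := hG.preconnected.exists_adj_of_nontrivial v
  by_cases h : ∀ x, G.Adj v x → x = w
  · refine .inr ⟨v, w, hw, h, hv, ?_⟩
    have hdeg : G.degree v = 1 :=
      degree_eq_one_iff_existsUnique_adj.2 ⟨w, hw, h⟩
    have hcard := G.card_edgeFinset_induce_compl_singleton v
    rw [card_edgeFinset_deleteIncidenceSet, hdeg] at hcard
    rw [Set.ncard_eq_toFinset_card'] at hk ⊢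
    simp only [edgeFinset] at hcard
    omega
  · push Not at h
    obtain ⟨x, hx, hxw⟩ := h
    refine .inl ⟨v, w, hw, ?_, ?_⟩
    · let f : G.induce {v}ᶜ →g G.deleteEdges {s(v, w)} :=
        ⟨Subtype.val, fun {a b} hab => by
          have ha := a.2
          have hb := b.2
          simp only [Set.mem_compl_iff, Set.mem_singleton_iff] at ha hb
          simp_all [deleteEdges_adj]⟩
      refine hv.of_hom_of_adj f (v := v) (x := ⟨x, hx.ne'⟩) ?_ fun y hy => ⟨⟨y, hy⟩, rfl⟩
      have hvx := hx.ne
      simp_all [f, deleteEdges_adj]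
    · rw [edgeSet_deleteEdges, Set.ncard_sdiff_singleton_of_mem (by simpa using hw), hk]
      rfl

end SimpleGraph

namespace Graphlet

open SimpleGraph

/-! ### Coded graphs -/

/-- The edge `{i, j}` is recorded by the binary digit of `a` at the place `2 ^ i + 2 ^ j`. -/
def hasEdge (a i j : ℕ) : Bool := !(i == j) && a.testBit (2 ^ i + 2 ^ j)

def addEdge (a i j : ℕ) : ℕ := a ||| 2 ^ (2 ^ i + 2 ^ j)

/-- `∑ i < n, f i`, in a form which the kernel evaluates directly. -/
def sumBelow : ℕ → (ℕ → ℕ) → ℕ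
  | 0, _ => 0
  | n + 1, f => sumBelow n f + f n

def codeDegree (n a v : ℕ) : ℕ :=
  sumBelow n fun u => bif hasEdge a v u then 1 else 0

def codeWeight (n a v w : ℕ) : ℕ :=
  1 + sumBelow n fun u => bif hasEdge a v u && hasEdge a w u then 1 else 0

def codeInvariant (n a : ℕ) : ℕ :=
  sumBelow n fun v => (sumBelow n fun w =>
    bif hasEdge a v w then codeWeight n a v w * (sumBelow n fun u =>
      bif hasEdge a w u then codeWeight n a w u else 0) ^ 2 else 0) ^ 2

/-- The assignments `x.1 ↦ x.2` and `y.1 ↦ y.2` can occur in the same isomorphism. -/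
def compatible (a b : ℕ) (x y : ℕ × ℕ) : Bool :=
  !(x.2 == y.2) && (hasEdge a x.1 y.1 == hasEdge b x.2 y.2)

/-- Backtracking search for an extension of the partial isomorphism `p` to the vertices in the
given list. -/
def matchable (n a b : ℕ) : List ℕ → List (ℕ × ℕ) → Bool
  | [], _ => true
  | v :: vs, p => (List.range n).any fun w =>
      codeDegree n a v == codeDegree n b w && p.all (compatible a b (v, w)) &&
        matchable n a b vs ((v, w) :: p)

/-- All graphs obtained by adding one edge, possibly to a new vertex. -/
def extensions (n a : ℕ) : List (ℕ × ℕ) :=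
  (List.range n).map (fun u => (n + 1, addEdge a u n)) ++
    (List.range n).flatMap fun v =>
      ((List.range v).filter fun u => !hasEdge a u v).map fun u => (n, addEdge a u v)

/-- A graph on `Fin order` together with its invariant. -/
structure Code where
  order : ℕ
  mask : ℕ
  key : ℕ

/-- `f x`, with `x` evaluated first when the kernel reduces the term. -/
def withValue {α : Type} (x : ℕ) (f : ℕ → α) : α :=
  match x with
  | 0 => f 0
  | m + 1 => f m.succ

def insertNew : List (ℕ × ℕ) → List Code → List Code
  | [], acc => acc
  | x :: xs, acc =>
    withValue x.1 fun n => withValue x.2 fun a => withValue (codeInvariant n a) fun h =>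
      bif acc.any fun c =>
          c.key == h && (c.order == n && matchable n a c.mask (List.range n) []) then
        insertNew xs acc
      else insertNew xs (⟨n, a, h⟩ :: acc)

/-- Representatives of the connected graphs with `k` edges. -/
def level : ℕ → List Code
  | 0 => [⟨1, 0, 0⟩]
  | k + 1 => insertNew ((level k).flatMap fun c => extensions c.order c.mask) []

theorem level_seven :
    (level 7).length = 79 ∧ (level 7).Pairwise (fun c d => c.key ≠ d.key) := by
  decide +kernel

theorem withValue_eq {α : Type} (x : ℕ) (f : ℕ → α) : withValue x f = f x := by
  cases x <;> rfl

theorem sumBelow_eq (n : ℕ) (f : ℕ → ℕ) : sumBelow n f = ∑ i : Fin n, f i := by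
  induction n with
  | zero => rfl
  | succ n ih => rw [sumBelow, ih, Fin.sum_univ_castSucc]; simp

theorem two_pow_add_two_pow_inj {i j u v : ℕ} (hij : i ≠ j) (huv : u ≠ v) :
    2 ^ i + 2 ^ j = 2 ^ u + 2 ^ v ↔ i = u ∧ j = v ∨ i = v ∧ j = u := by
  refine ⟨fun h => ?_, by rintro (⟨rfl, rfl⟩ | ⟨rfl, rfl⟩) <;> simp [add_comm]⟩
  have h' : ({i, j} : Finset ℕ) = {u, v} :=
    Finset.geomSum_injective le_rfl (by simpa [Finset.sum_pair, hij, huv] using h)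
  have hi : i ∈ ({u, v} : Finset ℕ) := h' ▸ by simp
  have hj : j ∈ ({u, v} : Finset ℕ) := h' ▸ by simp
  simp only [Finset.mem_insert, Finset.mem_singleton] at hi hj
  omega

theorem hasEdge_addEdge {a u v : ℕ} (huv : u ≠ v) (i j : ℕ) :
    hasEdge (addEdge a u v) i j = true ↔
      hasEdge a i j = true ∨ (i = u ∧ j = v ∨ i = v ∧ j = u) := by
  by_cases hij : i = j
  · simp only [hasEdge, hij, beq_self_eq_true, Bool.not_true, Bool.false_and, Bool.false_eq_true,
      false_or, false_iff]
    omega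
  · rw [← two_pow_add_two_pow_inj hij huv]
    simp only [hasEdge, addEdge, Nat.testBit_or, Nat.testBit_two_pow,
      Bool.or_eq_true, decide_eq_true_eq, beq_eq_false_iff_ne.2 hij,
      Bool.not_false, Bool.true_and, @eq_comm _ (2 ^ u + 2 ^ v)]

theorem addEdge_comm (a u v : ℕ) : addEdge a u v = addEdge a v u := by
  rw [addEdge, addEdge, add_comm]

theorem hasEdge_comm (a i j : ℕ) : hasEdge a i j = hasEdge a j i := by
  rw [hasEdge, hasEdge, add_comm, Bool.beq_comm]

theorem hasEdge_self (a i : ℕ) : hasEdge a i i = false := by simp [hasEdge]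

theorem addEdge_lt {a u v n m : ℕ} (ha : a < 2 ^ 2 ^ n) (hnm : n ≤ m) (huv : u < v) (hv : v < m) :
    addEdge a u v < 2 ^ 2 ^ m := by
  refine Nat.or_lt_two_pow (ha.trans_le ?_) (Nat.pow_lt_pow_right one_lt_two ?_)
  · exact Nat.pow_le_pow_right two_pos (Nat.pow_le_pow_right two_pos hnm)
  · have h₁ : 2 ^ u < 2 ^ v := Nat.pow_lt_pow_right one_lt_two huv
    have h₂ : 2 ^ (v + 1) ≤ 2 ^ m := Nat.pow_le_pow_right two_pos hv
    omega

theorem hasEdge_eq_false_of_lt {a n : ℕ} (ha : a < 2 ^ 2 ^ n) (i : ℕ) : hasEdge a i n = false := by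
  have h : a.testBit (2 ^ i + 2 ^ n) = false := Nat.testBit_lt_two_pow <|
    ha.trans_le <| Nat.pow_le_pow_right two_pos <| Nat.le_add_left _ _
  simp [hasEdge, h]

/-- The graph on `Fin n` with code `a`. -/
def codeGraph (n a : ℕ) : SimpleGraph (Fin n) where
  Adj i j := hasEdge a i j = true
  symm := ⟨fun i j h => by rwa [hasEdge_comm]⟩
  loopless := ⟨fun i h => by simp [hasEdge_self] at h⟩

theorem codeGraph_adj {n a : ℕ} {i j : Fin n} :
    (codeGraph n a).Adj i j ↔ hasEdge a i j = true := Iff.rfl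

theorem codeInvariant_eq (n a : ℕ) : codeInvariant n a = (codeGraph n a).weightInvariant := by
  simp only [codeInvariant, codeWeight, weightInvariant, pairWeight, sumBelow_eq, codeGraph_adj,
    Bool.cond_eq_ite, Bool.and_eq_true]

/-! ### The search for isomorphisms -/

theorem compatible_symm {a b : ℕ} {x y : ℕ × ℕ} (h : compatible a b x y = true) :
    compatible a b y x = true := by
  simp only [compatible, Bool.and_eq_true, Bool.not_eq_true', beq_eq_false_iff_ne, beq_iff_eq] at *
  rw [hasEdge_comm a, hasEdge_comm b]
  exact ⟨h.1.symm, h.2⟩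

theorem exists_assignment_of_matchable {n a b : ℕ} {vs : List ℕ} {p : List (ℕ × ℕ)}
    (hp : p.Pairwise fun x y => compatible a b x y = true)
    (h : matchable n a b vs p = true) :
    ∃ q : List (ℕ × ℕ), (q.Pairwise fun x y => compatible a b x y = true) ∧ p ⊆ q ∧
      ∀ v ∈ vs, ∃ w < n, (v, w) ∈ q := by
  induction vs generalizing p with
  | nil => exact ⟨p, hp, List.Subset.refl p, by simp⟩
  | cons v vs ih =>
    simp only [matchable, List.any_eq_true, List.mem_range, Bool.and_eq_true, List.all_eq_true] at h
    obtain ⟨w, hw, ⟨-, hc⟩, hm⟩ := h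
    obtain ⟨q, hq, hpq, hvs⟩ := ih (List.pairwise_cons.2 ⟨hc, hp⟩) hm
    rw [List.cons_subset] at hpq
    refine ⟨q, hq, hpq.2, fun x hx => ?_⟩
    obtain rfl | hx := List.mem_cons.1 hx
    · exact ⟨w, hw, hpq.1⟩
    · exact hvs x hx

theorem nonempty_iso_of_matchable {n a b : ℕ} (h : matchable n a b (List.range n) [] = true) :
    Nonempty (codeGraph n a ≃g codeGraph n b) := by
  obtain ⟨q, hq, -, hv⟩ := exists_assignment_of_matchable List.Pairwise.nil h
  have hex : ∀ i : Fin n, ∃ w : Fin n, ((i : ℕ), (w : ℕ)) ∈ q := fun i => by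
    obtain ⟨w, hw, hmem⟩ := hv i (List.mem_range.2 i.2)
    exact ⟨⟨w, hw⟩, hmem⟩
  choose f hf using hex
  have hc : ∀ i j, i ≠ j → f i ≠ f j ∧ (hasEdge a i j = hasEdge b (f i) (f j)) := fun i j hij => by
    have hne : ((i : ℕ), (f i : ℕ)) ≠ ((j : ℕ), (f j : ℕ)) :=
      fun h => hij (Fin.ext (Prod.ext_iff.1 h).1)
    have : Std.Symm fun x y => compatible a b x y = true := ⟨fun _ _ => compatible_symm⟩
    have := hq.forall (hf i) (hf j) hne
    simpa [compatible, Fin.val_inj] using this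
  have hinj : Function.Injective f := fun i j hij => by
    by_contra hne
    exact (hc i j hne).1 hij
  refine ⟨⟨Equiv.ofBijective f (Finite.injective_iff_bijective.1 hinj), fun {i j} => ?_⟩⟩
  by_cases hij : i = j
  · simp [hij]
  · simp [codeGraph_adj, (hc i j hij).2]

/-! ### Extending by one edge -/

theorem mem_extensions {n a : ℕ} {x : ℕ × ℕ} :
    x ∈ extensions n a ↔ (∃ u < n, x = (n + 1, addEdge a u n)) ∨
      ∃ v < n, ∃ u < v, hasEdge a u v = false ∧ x = (n, addEdge a u v) := by
  simp [extensions, @eq_comm _ _ x, and_assoc]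

theorem codeGraph_addEdge {n a : ℕ} {u v : Fin n} (huv : u ≠ v) :
    codeGraph n (addEdge a u v) = codeGraph n a ⊔ edge u v := by
  ext i j
  have huv' := Fin.val_ne_of_ne huv
  rw [sup_adj, edge_adj, codeGraph_adj, codeGraph_adj, hasEdge_addEdge huv']
  grind

theorem codeGraph_succ {n a : ℕ} (ha : a < 2 ^ 2 ^ n) :
    codeGraph (n + 1) a = (codeGraph n a).map Fin.castSuccEmb := by
  ext i j
  rw [map_adj]
  induction i using Fin.lastCases with
  | last => simp [codeGraph_adj, hasEdge_comm a n, hasEdge_eq_false_of_lt ha,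
      Fin.castSucc_ne_last]
  | cast i =>
    induction j using Fin.lastCases with
    | last => simp [codeGraph_adj, hasEdge_eq_false_of_lt ha, Fin.castSucc_ne_last]
    | cast j => simp [codeGraph_adj]

/-- The listed graphs are connected with `k` edges, and carry their invariant. -/
structure Code.Valid (k : ℕ) (c : Code) : Prop where
  mask_lt : c.mask < 2 ^ 2 ^ c.order
  connected : (codeGraph c.order c.mask).Connected
  ncard_edgeSet : (codeGraph c.order c.mask).edgeSet.ncard = k
  key_eq : c.key = codeInvariant c.order c.mask

theorem ncard_edgeSet_sup_edge {V : Type*} [Finite V] {G : SimpleGraph V} {u v : V} (huv : u ≠ v)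
    (h : ¬G.Adj u v) : (G ⊔ edge u v).edgeSet.ncard = G.edgeSet.ncard + 1 := by
  rw [edgeSet_sup, edgeSet_edge_of_ne huv, Set.union_singleton,
    Set.ncard_insert_of_notMem (by simpa using h)]

theorem Code.Valid.extension {k : ℕ} {c : Code} (hc : c.Valid k) {x : ℕ × ℕ}
    (hx : x ∈ extensions c.order c.mask) :
    Code.Valid (k + 1) ⟨x.1, x.2, codeInvariant x.1 x.2⟩ := by
  obtain ⟨n, a, h⟩ := c
  obtain ⟨ha, hconn, hcard, -⟩ := hc
  dsimp only at *
  obtain ⟨u, hu, rfl⟩ | ⟨v, hv, u, hu, huv, rfl⟩ := mem_extensions.1 hx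
  · have hne : (⟨u, hu⟩ : Fin n).castSucc ≠ Fin.last n := Fin.castSucc_ne_last _
    have heq : codeGraph (n + 1) (addEdge a u n) =
        (codeGraph n a).map Fin.castSuccEmb ⊔ edge (⟨u, hu⟩ : Fin n).castSucc (Fin.last n) := by
      rw [← codeGraph_succ ha, ← codeGraph_addEdge hne]
      simp
    refine ⟨addEdge_lt ha n.le_succ hu n.lt_succ_self, ?_, ?_, rfl⟩
    · dsimp only
      rw [heq]
      refine hconn.of_hom_of_adj (v := Fin.last n) (x := ⟨u, hu⟩)
        ((Hom.ofLE le_sup_left).comp (Embedding.map Fin.castSuccEmb _).toHom) ?_ fun y hy => ?_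
      · exact .inr ((edge_adj ..).2 ⟨.inr ⟨rfl, rfl⟩, hne.symm⟩)
      · exact ⟨y.castPred hy, y.castSucc_castPred hy⟩
    · dsimp only
      rw [heq, ncard_edgeSet_sup_edge hne, edgeSet_map, Set.ncard_image_of_injective _
        (Function.Embedding.injective _), hcard]
      rw [map_adj]
      simp [Fin.castSucc_ne_last]
  · have hne : (⟨u, hu.trans hv⟩ : Fin n) ≠ ⟨v, hv⟩ := by simpa using hu.ne
    have heq := codeGraph_addEdge (a := a) hne
    refine ⟨addEdge_lt ha le_rfl hu hv, ?_, ?_, rfl⟩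
    · dsimp only at heq ⊢
      rw [heq]
      exact hconn.mono le_sup_left
    · dsimp only at heq ⊢
      rw [heq, ncard_edgeSet_sup_edge hne (by simp [codeGraph_adj, huv]), hcard]

universe u

theorem exists_iso_extension {V : Type u} [Finite V] {G : SimpleGraph V} {k : ℕ}
    (hG : G.Connected) (hk : G.edgeSet.ncard = k + 1) :
    ∃ (W : Type u) (_ : Finite W) (H : SimpleGraph W), H.Connected ∧ H.edgeSet.ncard = k ∧
      ∀ n a, a < 2 ^ 2 ^ n → Nonempty (H ≃g codeGraph n a) →
        ∃ x ∈ extensions n a, Nonempty (G ≃g codeGraph x.1 x.2) := by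
  classical
  obtain ⟨v, w, hvw, hc, hcard⟩ | ⟨v, w, hvw, hw, hc, hcard⟩ := hG.exists_deleteEdges_or_induce hk
  · refine ⟨V, inferInstance, _, hc, hcard, fun n a _ ⟨φ⟩ => ?_⟩
    have hne : φ v ≠ φ w := φ.injective.ne hvw.ne
    have hadj : hasEdge a (φ v) (φ w) = false := by
      rw [← Bool.not_eq_true, ← codeGraph_adj, φ.map_adj_iff]
      simp [deleteEdges_adj]
    refine ⟨(n, addEdge a (φ v) (φ w)), mem_extensions.2 (.inr ?_), ⟨φ.toEquiv, fun {i j} => ?_⟩⟩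
    · rcases lt_or_gt_of_ne hne with hlt | hlt
      · exact ⟨φ w, (φ w).2, φ v, hlt, hadj, rfl⟩
      · exact ⟨φ v, (φ v).2, φ w, hlt, by rwa [hasEdge_comm], by rw [addEdge_comm]⟩
    · dsimp only
      rw [codeGraph_addEdge hne, sup_adj, edge_adj, RelIso.coe_fn_toEquiv, φ.map_adj_iff,
        deleteEdges_adj]
      simp only [Set.mem_singleton_iff, Sym2.eq_iff, φ.injective.eq_iff, φ.injective.ne_iff]
      have := hvw.symm
      have := G.ne_of_adj (a := i) (b := j)
      grind
  · refine ⟨_, inferInstance, _, hc, hcard, fun n a ha ⟨φ⟩ => ?_⟩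
    let u := φ ⟨w, hvw.ne'⟩
    have hne : u.castSucc ≠ Fin.last n := Fin.castSucc_ne_last _
    have heq : codeGraph (n + 1) (addEdge a u n) =
        (codeGraph n a).map Fin.castSuccEmb ⊔ edge u.castSucc (Fin.last n) := by
      rw [← codeGraph_succ ha, ← codeGraph_addEdge hne]
      simp
    let f : V → Fin (n + 1) := fun x => if h : x = v then Fin.last n else (φ ⟨x, h⟩).castSucc
    have hfv : f v = Fin.last n := by simp [f]
    have hf : ∀ x : ({v}ᶜ : Set V), f x = (φ x).castSucc := fun x => by
      have hx : x.1 ≠ v := x.2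
      simp [f, hx]
    have hbij : f.Bijective := by
      refine ⟨fun x y hxy => ?_, fun i => ?_⟩
      · by_cases hx : x = v <;> by_cases hy : y = v <;>
          simp [f, hx, hy, Fin.castSucc_ne_last, (Fin.castSucc_ne_last _).symm] at hxy ⊢
        exact congrArg Subtype.val hxy
      · induction i using Fin.lastCases with
        | last => exact ⟨v, hfv⟩
        | cast i => exact ⟨φ.symm i, by rw [hf, φ.apply_symm_apply]⟩
    refine ⟨(n + 1, addEdge a u n), mem_extensions.2 (.inl ⟨u, u.2, rfl⟩),
      ⟨Equiv.ofBijective f hbij, fun {i j} => ?_⟩⟩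
    dsimp only
    rw [heq, Equiv.ofBijective_apply, Equiv.ofBijective_apply, sup_adj, edge_adj]
    have hadj (x : V) : G.Adj v x ↔ x = w := ⟨hw x, fun h => h ▸ hvw⟩
    by_cases hi : i = v <;> by_cases hj : j = v
    · simp [hi, hj]
    · obtain ⟨j, rfl⟩ : ∃ j' : ({v}ᶜ : Set V), j'.1 = j := ⟨⟨j, hj⟩, rfl⟩
      rw [hi, hfv, hf, hadj, map_adj]
      simp [Fin.castSucc_ne_last, hne.symm, u, Subtype.ext_iff,
        (Fin.castSucc_ne_last _).symm]
    · obtain ⟨i, rfl⟩ : ∃ i' : ({v}ᶜ : Set V), i'.1 = i := ⟨⟨i, hi⟩, rfl⟩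
      rw [hj, hfv, hf, G.adj_comm, hadj, map_adj]
      simp [Fin.castSucc_ne_last, u, Subtype.ext_iff]
    · obtain ⟨i, rfl⟩ : ∃ i' : ({v}ᶜ : Set V), i'.1 = i := ⟨⟨i, hi⟩, rfl⟩
      obtain ⟨j, rfl⟩ : ∃ j' : ({v}ᶜ : Set V), j'.1 = j := ⟨⟨j, hj⟩, rfl⟩
      rw [hf, hf]
      simp only [Fin.castSucc_ne_last, and_false, false_and, or_false]
      rw [← Fin.coe_castSuccEmb, map_adj_apply, φ.map_adj_iff]
      rfl

/-! ### The lists of representatives -/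

theorem insertNew_cons (x : ℕ × ℕ) (xs : List (ℕ × ℕ)) (acc : List Code) :
    (insertNew (x :: xs) acc = insertNew xs acc ∧
      ∃ c ∈ acc, Nonempty (codeGraph x.1 x.2 ≃g codeGraph c.order c.mask)) ∨
    insertNew (x :: xs) acc = insertNew xs (⟨x.1, x.2, codeInvariant x.1 x.2⟩ :: acc) := by
  simp only [insertNew, withValue_eq]
  rw [Bool.cond_eq_ite]
  split_ifs with h
  · simp only [List.any_eq_true, Bool.and_eq_true, beq_iff_eq] at h
    obtain ⟨⟨m, b, l⟩, hc, -, rfl, h⟩ := h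
    exact .inl ⟨rfl, _, hc, nonempty_iso_of_matchable h⟩
  · exact .inr rfl

theorem subset_insertNew (xs : List (ℕ × ℕ)) (acc : List Code) : acc ⊆ insertNew xs acc := by
  induction xs generalizing acc with
  | nil => exact List.Subset.refl acc
  | cons x xs ih =>
    obtain ⟨h, -⟩ | h := insertNew_cons x xs acc <;> rw [h]
    · exact ih acc
    · exact List.Subset.trans (List.subset_cons_self _ _) (ih _)

theorem exists_iso_mem_insertNew {xs : List (ℕ × ℕ)} {x : ℕ × ℕ} (hx : x ∈ xs)
    (acc : List Code) :
    ∃ c ∈ insertNew xs acc, Nonempty (codeGraph x.1 x.2 ≃g codeGraph c.order c.mask) := by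
  induction xs generalizing acc with
  | nil => simp at hx
  | cons y xs ih =>
    obtain rfl | hx := List.mem_cons.1 hx
    · obtain ⟨h, c, hc, hiso⟩ | h := insertNew_cons x xs acc <;> rw [h]
      · exact ⟨c, subset_insertNew xs acc hc, hiso⟩
      · exact ⟨_, subset_insertNew xs _ List.mem_cons_self, ⟨Iso.refl⟩⟩
    · obtain ⟨h, -⟩ | h := insertNew_cons y xs acc <;> rw [h] <;> exact ih hx _

theorem of_mem_insertNew {P : Code → Prop} {xs : List (ℕ × ℕ)} {acc : List Code}
    (hacc : ∀ c ∈ acc, P c) (hxs : ∀ x ∈ xs, P ⟨x.1, x.2, codeInvariant x.1 x.2⟩) :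
    ∀ c ∈ insertNew xs acc, P c := by
  induction xs generalizing acc with
  | nil => exact hacc
  | cons x xs ih =>
    obtain ⟨hx, hxs⟩ := List.forall_mem_cons.1 hxs
    obtain ⟨h, -⟩ | h := insertNew_cons x xs acc <;> rw [h]
    · exact ih hacc hxs
    · exact ih (List.forall_mem_cons.2 ⟨hx, hacc⟩) hxs

theorem valid_of_mem_level {k : ℕ} {c : Code} (hc : c ∈ level k) : c.Valid k := by
  induction k generalizing c with
  | zero =>
    obtain rfl := List.mem_singleton.1 hc
    have hbot : codeGraph 1 0 = ⊥ := Subsingleton.elim _ _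
    exact ⟨by norm_num, hbot ▸ Connected.of_subsingleton, by simp [hbot], by decide⟩
  | succ k ih =>
    refine of_mem_insertNew (by simp) (fun x hx => ?_) c hc
    obtain ⟨d, hd, hx⟩ := List.mem_flatMap.1 hx
    exact (ih hd).extension hx

theorem exists_mem_level_iso {V : Type u} [Finite V] {G : SimpleGraph V} {k : ℕ}
    (hG : G.Connected) (hk : G.edgeSet.ncard = k) :
    ∃ c ∈ level k, Nonempty (G ≃g codeGraph c.order c.mask) := by
  induction k generalizing V with
  | zero =>
    have hbot : G = ⊥ := edgeSet_eq_empty.1 ((Set.ncard_eq_zero (Set.toFinite _)).1 hk)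
    subst hbot
    have : Subsingleton V := by
      by_contra h
      rw [not_subsingleton_iff_nontrivial] at h
      obtain ⟨v⟩ := hG.nonempty
      obtain ⟨w, hw⟩ := hG.preconnected.exists_adj_of_nontrivial v
      exact hw
    have : Unique V := uniqueOfSubsingleton hG.nonempty.some
    refine ⟨_, List.mem_singleton_self _, ⟨Equiv.ofUnique V (Fin 1), fun {i j} => ?_⟩⟩
    simp [Subsingleton.elim i j]
  | succ k ih =>
    obtain ⟨W, _, H, hH, hcard, hext⟩ := exists_iso_extension hG hk
    obtain ⟨d, hd, hiso⟩ := ih hH hcard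
    obtain ⟨x, hx, ⟨φ⟩⟩ := hext _ _ (valid_of_mem_level hd).mask_lt hiso
    have hmem : x ∈ (level k).flatMap fun c => extensions c.order c.mask :=
      List.mem_flatMap.2 ⟨d, hd, hx⟩
    obtain ⟨c, hc, ⟨ψ⟩⟩ := exists_iso_mem_insertNew hmem []
    exact ⟨c, hc, ⟨φ.trans ψ⟩⟩

/-- The invariant on isomorphism classes. -/
noncomputable def classInvariant (k : ℕ) : Quot (@graphletIso k) → ℕ :=
  Quot.lift (fun G => G.1.2.weightInvariant) fun _ _ ⟨φ⟩ => φ.weightInvariant_eq.symm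

theorem exists_mem_level_key {k : ℕ} (G : Graphlet k) :
    ∃ c ∈ level k, Nonempty (G.1.2 ≃g codeGraph c.order c.mask) ∧
      c.key = G.1.2.weightInvariant := by
  obtain ⟨c, hc, ⟨φ⟩⟩ := exists_mem_level_iso G.2.1 G.2.2.2
  exact ⟨c, hc, ⟨φ⟩, by
    rw [(valid_of_mem_level hc).key_eq, codeInvariant_eq, φ.weightInvariant_eq]⟩

theorem classInvariant_injective {k : ℕ}
    (hk : (level k).Pairwise fun c d => c.key ≠ d.key) :
    Function.Injective (classInvariant k) := by
  rintro ⟨G⟩ ⟨H⟩ hGH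
  obtain ⟨c, hc, ⟨φ⟩, hcG⟩ := exists_mem_level_key G
  obtain ⟨d, hd, ⟨ψ⟩, hdH⟩ := exists_mem_level_key H
  obtain rfl : c = d := by
    by_contra hne
    have : Std.Symm fun c d : Code => c.key ≠ d.key := ⟨fun _ _ => Ne.symm⟩
    exact hk.forall hc hd hne (hcG.trans (hGH.trans hdH.symm))
  exact Quot.sound ⟨φ.trans ψ.symm⟩

theorem range_classInvariant {k : ℕ} (hk : k ≠ 0) :
    Set.range (classInvariant k) = (((level k).map Code.key).toFinset : Set ℕ) := by
  ext h
  simp only [Set.mem_range, List.coe_toFinset, List.mem_map, Set.mem_ofPred_eq]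
  constructor
  · rintro ⟨⟨G⟩, rfl⟩
    obtain ⟨c, hc, -, hcG⟩ := exists_mem_level_key G
    exact ⟨c, hc, hcG⟩
  · rintro ⟨c, hc, rfl⟩
    have hv := valid_of_mem_level hc
    have : Nontrivial (Fin c.order) := by
      by_contra h
      rw [not_nontrivial_iff_subsingleton] at h
      have hbot : codeGraph c.order c.mask = ⊥ := Subsingleton.elim _ _
      exact hk (by simpa [hbot] using hv.ncard_edgeSet.symm)
    refine ⟨Quot.mk _ ⟨⟨c.order, codeGraph c.order c.mask⟩, hv.connected,
      hv.connected.preconnected.exists_adj_of_nontrivial, hv.ncard_edgeSet⟩, ?_⟩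
    rw [hv.key_eq, codeInvariant_eq]
    rfl

theorem card_quot_graphletIso {k : ℕ} (hk : k ≠ 0)
    (hkey : (level k).Pairwise fun c d => c.key ≠ d.key) :
    Nat.card (Quot (@graphletIso k)) = (level k).length := by
  rw [← Set.ncard_range_of_injective (classInvariant_injective hkey), range_classInvariant hk,
    Set.ncard_coe_finset, List.toFinset_card_of_nodup (List.pairwise_map.2 hkey), List.length_map]

end Graphlet

/-- The number of isomorphism classes of finite connected simple graphs with no
isolated vertices having exactly 7 edges is 79. -/
theorem graphlet_count_7 :
    Nat.card (Quot (@graphletIso 7)) = 79 := by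
  rw [Graphlet.card_quot_graphletIso (by norm_num) Graphlet.level_seven.2, Graphlet.level_seven.1]
end

section
/- The number of isomorphism classes of finite connected simple graphs with no isolated vertices having exactly 8 edges is 227. -/
namespace SimpleGraph

variable {V W : Type*} {G : SimpleGraph V} {H : SimpleGraph W}

theorem Iso.ncard_edgeSet (e : G ≃g H) : G.edgeSet.ncard = H.edgeSet.ncard :=
  Nat.card_congr e.mapEdgeSet

theorem ncard_edgeSet_deleteEdges_singleton [Finite V] {u v : V} (h : G.Adj u v) :
    G.edgeSet.ncard = (G.deleteEdges {s(u, v)}).edgeSet.ncard + 1 := by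
  rw [edgeSet_deleteEdges]
  exact (Set.ncard_sdiff_singleton_add_one (s := G.edgeSet) (a := s(u, v)) h (Set.toFinite _)).symm

/-- `v` is a leaf of `G`, attached to `a`. -/
def IsLeafAt (G : SimpleGraph V) (v a : V) : Prop := ∀ x, G.Adj v x ↔ x = a

theorem IsLeafAt.ne {v a : V} (h : G.IsLeafAt v a) : a ≠ v := by
  rintro rfl
  exact G.loopless.irrefl a ((h a).2 rfl)

theorem IsLeafAt.degree_eq_one [Finite V] {v a : V} [Fintype (G.neighborSet v)]
    (h : G.IsLeafAt v a) : G.degree v = 1 :=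
  degree_eq_one_iff_existsUnique_adj.2 ⟨a, (h a).2 rfl, fun y hy => (h y).1 hy⟩

theorem IsLeafAt.ncard_edgeSet [Finite V] {v a : V} (h : G.IsLeafAt v a) :
    G.edgeSet.ncard = (G.induce {v}ᶜ).edgeSet.ncard + 1 := by
  classical
  have := Fintype.ofFinite V
  have hd := h.degree_eq_one
  have h1 := G.card_edgeFinset_induce_compl_singleton v
  have h2 := G.card_edgeFinset_deleteIncidenceSet v
  have h3 := G.degree_le_card_edgeFinset v
  rw [← coe_edgeFinset, ← coe_edgeFinset, Set.ncard_coe_finset, Set.ncard_coe_finset]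
  omega

open Classical in
theorem degree_induce_compl_singleton [Fintype V] (G : SimpleGraph V) {v : V}
    (b : ({v}ᶜ : Set V)) :
    G.degree b = (G.induce {v}ᶜ).degree b + if G.Adj b v then 1 else 0 := by
  have h1 := G.degree_eq_sum_if_adj (R := ℕ) b
  have h2 := (G.induce {v}ᶜ).degree_eq_sum_if_adj (R := ℕ) b
  rw [Fintype.sum_eq_add_sum_subtype_ne _ v, add_comm] at h1
  rw [Nat.cast_id] at h1 h2
  convert h1
  rw [h2]
  rfl

/-- Deleting a leaf keeps the other leaves, unless they form an edge with it. -/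
theorem IsLeafAt.of_induce {v a : V} (h : G.IsLeafAt v a) {x y : ({v}ᶜ : Set V)}
    (hxy : (G.induce {v}ᶜ).IsLeafAt x y) (hx : (x : V) ≠ a) : G.IsLeafAt x y := by
  intro z
  by_cases hz : z = v
  · subst hz
    rw [G.adj_comm, h]
    exact iff_of_false hx fun h' => y.2 h'.symm
  · exact (hxy ⟨z, hz⟩).trans Subtype.ext_iff

theorem exists_isLeafAt_forall_degree_le [Fintype V] [∀ x, Fintype (G.neighborSet x)]
    (h : ∃ v a, G.IsLeafAt v a) :
    ∃ v a, G.IsLeafAt v a ∧ ∀ x y, G.IsLeafAt x y → G.degree y ≤ G.degree a := by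
  obtain ⟨v, a, h⟩ := h
  have : Nonempty {p : V × V // G.IsLeafAt p.1 p.2} := ⟨⟨(v, a), h⟩⟩
  obtain ⟨p, hp⟩ :=
    Finite.exists_max fun p : {p : V × V // G.IsLeafAt p.1 p.2} => G.degree p.1.2
  exact ⟨p.1.1, p.1.2, p.2, fun x y hxy => hp ⟨(x, y), hxy⟩⟩

theorem IsLeafAt.connected_induce [Finite V] {v a : V} (h : G.IsLeafAt v a) (hG : G.Connected) :
    (G.induce {v}ᶜ).Connected := by
  classical
  have := Fintype.ofFinite V
  exact hG.induce_compl_singleton_of_degree_eq_one h.degree_eq_one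

theorem IsLeafAt.connected {v a : V} (h : G.IsLeafAt v a) (hG : (G.induce {v}ᶜ).Connected) :
    G.Connected := by
  refine (connected_iff_exists_forall_reachable G).2 ⟨a, fun x => ?_⟩
  by_cases hx : x = v
  · exact hx ▸ ((h a).2 rfl).symm.reachable
  · exact (hG.preconnected ⟨a, h.ne⟩ ⟨x, hx⟩).map (Embedding.induce _).toHom

/-- Graphs with a leaf are isomorphic if deleting the leaves gives isomorphic graphs
with corresponding points of attachment. -/
theorem IsLeafAt.nonempty_iso {v a : V} {w b : W} (hG : G.IsLeafAt v a) (hH : H.IsLeafAt w b)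
    (e : G.induce {v}ᶜ ≃g H.induce {w}ᶜ) (he : (e ⟨a, hG.ne⟩ : W) = b) : Nonempty (G ≃g H) := by
  classical
  let g : {x // x ≠ v} ≃ {x // x ≠ w} := e.toEquiv
  let f : V ≃ W := (Equiv.optionSubtypeNe v).symm.trans
    (g.optionCongr.trans (Equiv.optionSubtypeNe w))
  have fv : f v = w := by simp [f]
  have fx : ∀ x (hx : x ≠ v), f x = e ⟨x, hx⟩ := fun x hx => by
    have : f x = g ⟨x, hx⟩ := by simp [f, Equiv.optionSubtypeNe_symm_of_ne hx]
    exact this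
  have fa : ∀ x, f x = b ↔ x = a := fun x => by
    rw [← he, ← fx a hG.ne, f.injective.eq_iff]
  refine ⟨⟨f, fun {x y} => ?_⟩⟩
  by_cases hx : x = v
  · subst hx
    rw [fv, hG y, hH, fa]
  by_cases hy : y = v
  · subst hy
    rw [fv, H.adj_comm, G.adj_comm, hG x, hH, fa]
  · rw [fx x hx, fx y hy]
    exact e.map_adj_iff (v := ⟨x, hx⟩) (w := ⟨y, hy⟩)

/-- Graphs are isomorphic if deleting corresponding edges gives isomorphic graphs. -/
theorem nonempty_iso_of_deleteEdges {u v : V} {G' : SimpleGraph W} (h : G.Adj u v)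
    (e : G.deleteEdges {s(u, v)} ≃g G') (hH : H.Adj (e u) (e v))
    (hG' : H.deleteEdges {s(e u, e v)} = G') : Nonempty (G ≃g H) := by
  refine ⟨⟨e.toEquiv, fun {x y} => ?_⟩⟩
  have h1 : (H.deleteEdges {s(e u, e v)}).Adj (e x) (e y) ↔ (G.deleteEdges {s(u, v)}).Adj x y := by
    rw [hG']; exact e.map_adj_iff
  rw [deleteEdges_adj, deleteEdges_adj] at h1
  have h2 : s(e x, e y) = s(e u, e v) ↔ s(x, y) = s(u, v) := by
    simp only [Sym2.eq_iff, e.injective.eq_iff]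
  by_cases h3 : s(x, y) = s(u, v)
  · have h4 : H.Adj (e x) (e y) := by
      rw [← mem_edgeSet, h2.2 h3]; exact hH
    have h5 : G.Adj x y := by
      rw [← mem_edgeSet, h3]; exact h
    exact iff_of_true h4 h5
  · have h4 := mt h2.1 h3
    simp only [Set.mem_singleton_iff, h3, h4, not_false_eq_true, and_true] at h1
    exact h1

/-- A finite connected graph with an edge has a leaf or an edge that is not a bridge. -/
theorem Connected.exists_isLeafAt_or_not_isBridge [Finite V] (hG : G.Connected)
    (hne : G.edgeSet.Nonempty) :
    (∃ v a, G.IsLeafAt v a) ∨ ∃ u v, G.Adj u v ∧ ¬G.IsBridge s(u, v) := by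
  classical
  have := Fintype.ofFinite V
  by_contra! hcon
  have htree : G.IsTree := ⟨hG, isAcyclic_iff_forall_adj_isBridge.2 hcon.2⟩
  obtain ⟨⟨x, y⟩, hxy⟩ := hne
  have : Nontrivial V := ⟨x, y, hxy.ne⟩
  obtain ⟨v, hv⟩ := htree.exists_vert_degree_one_of_nontrivial
  obtain ⟨a, ha, hu⟩ := degree_eq_one_iff_existsUnique_adj.1 hv
  exact hcon.1 v a fun x => ⟨hu x, fun h => h ▸ ha⟩

/-- The number of walks, with pauses allowed, of length `t` from `u` to `v`; that is, the entries
of the `t`-th power of the signless Laplacian. -/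
noncomputable def walkCount [Fintype V] (G : SimpleGraph V) (u : V) : ℕ → V → ℕ
  | 0, v => by classical exact if v = u then 1 else 0
  | t + 1, v => by
    classical exact ∑ w, if G.Adj v w then G.walkCount u t v + G.walkCount u t w else 0

theorem walkCount_le [Fintype V] (u : V) (t : ℕ) (v : V) :
    G.walkCount u t v ≤ (2 * Fintype.card V) ^ t := by
  classical
  induction t generalizing v with
  | zero => simp only [walkCount]; split_ifs <;> simp
  | succ t ih =>
    simp only [walkCount]
    calc _ ≤ ∑ _w : V, 2 * (2 * Fintype.card V) ^ t := by
          refine Finset.sum_le_sum fun w _ => ?_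
          have := ih v
          have := ih w
          split_ifs <;> omega
      _ = _ := by simp [pow_succ]; ring

theorem Iso.walkCount_eq [Fintype V] [Fintype W] (e : G ≃g H) (u : V) (t : ℕ) (v : V) :
    H.walkCount (e u) t (e v) = G.walkCount u t v := by
  classical
  induction t generalizing v with
  | zero => simp [walkCount]
  | succ t ih =>
    simp only [walkCount]
    rw [← e.toEquiv.sum_comp]
    refine Finset.sum_congr rfl fun w _ => ?_
    have := ih w
    simp only [RelIso.coe_fn_toEquiv, ih, e.map_adj_iff]

/-- The sum of the cubes of the entries of the fourth power of the signless Laplacian. -/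
noncomputable def walkInvariant [Fintype V] (G : SimpleGraph V) : ℕ :=
  ∑ v, ∑ u, G.walkCount u 4 v ^ 3

theorem Iso.walkInvariant_eq [Fintype V] [Fintype W] (e : G ≃g H) :
    G.walkInvariant = H.walkInvariant := by
  rw [walkInvariant, walkInvariant, ← e.toEquiv.sum_comp]
  refine Finset.sum_congr rfl fun v _ => ?_
  rw [← e.toEquiv.sum_comp]
  exact Finset.sum_congr rfl fun u _ => by rw [← e.walkCount_eq u 4 v]; rfl

end SimpleGraph

/-- `List.foldr`, defined by the recursor to make it cheap for kernel reduction. -/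
noncomputable def List.recFold {α β : Type*} (l : List α) (b : β) (f : α → β → β) : β :=
  List.rec b (fun a _ r => f a r) l

theorem List.recFold_eq_foldr {α β : Type*} (l : List α) (b : β) (f : α → β → β) :
    l.recFold b f = l.foldr f b := by
  induction l with
  | nil => rfl
  | cons a l ih => exact congrArg (f a) ih

/-- A graph on `{0, …, order - 1}` given by a list of edges. -/
structure EdgeList where
  order : ℕ
  edges : List (ℕ × ℕ)

namespace EdgeList

noncomputable section

/-! ### Computable operations

These are written with recursors and the binary operations of `ℕ`, so that the kernel evaluates
them fast. -/

def select (p : ℕ → Bool) (l : List ℕ) : List ℕ :=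
  l.recFold [] fun a r => bif p a then a :: r else r

def addUp (l : List ℕ) (f : ℕ → ℕ) : ℕ := l.recFold 0 fun a r => (f a).add r

/-- The `i`-th entry of `l`, or `0`. -/
def entry (l : List ℕ) (i : ℕ) : ℕ :=
  l.recFold (fun _ => 0) (fun a r i => Nat.rec a (fun j _ => r j) i) i

/-- The first position of `v` in `l`. -/
def index (l : List ℕ) (v : ℕ) : ℕ := l.recFold 0 fun w r => bif w.beq v then 0 else r.succ

def star (c : EdgeList) (v : ℕ) : List ℕ :=
  c.edges.recFold [] fun e l => bif e.1.beq v then e.2 :: l else bif e.2.beq v then e.1 :: l else l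

def adj (c : EdgeList) (i j : ℕ) : Bool :=
  (c.star i).recFold false fun k r => bif k.beq j then true else r

def neighbors (c : EdgeList) (v : ℕ) : List ℕ := select (c.adj v) (List.range c.order)

/-- The first `n` digits of `x` in base `b`. -/
def digits (b n x : ℕ) : List ℕ :=
  Nat.rec (fun _ => []) (fun _ r x => x.mod b :: r (x.div b)) n x

/-- Multiplication of a vector by the signless Laplacian given by the neighbors `N`. -/
def step (N : List (ℕ × List ℕ)) (R : List ℕ) : List ℕ :=
  N.map fun v => addUp v.2 fun w => (entry R v.1).add (entry R w)

/-- A bound for the entries of `rows`. -/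
def base (c : EdgeList) : ℕ := ((2 * c.order).pow 4).succ

/-- The rows of the fourth power of the signless Laplacian; each row is computed as a single
number in base `base c`. -/
def rows (c : EdgeList) : List (List ℕ) :=
  let N := (List.range c.order).map fun v => (v, c.neighbors v)
  List.map (digits c.base c.order)
    (step N (step N (step N (step N ((List.range c.order).map fun v => c.base.pow v)))))

def cubeSum (r : List ℕ) : ℕ := addUp r fun x => x.pow 3

def invariant (c : EdgeList) : ℕ := addUp (c.rows.map cubeSum) id

/-- The entry with the largest key, and the others; entries have the form `(key, vertex, row)`. -/
def pick (l : List (ℕ × ℕ × List ℕ)) :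
    ℕ × ℕ × List ℕ → (ℕ × ℕ × List ℕ) × List (ℕ × ℕ × List ℕ) :=
  l.recFold (fun b => (b, [])) fun a r b =>
    bif a.1.blt b.1 then ((r b).1, a :: (r b).2) else ((r a).1, b :: (r a).2)

/-- Remove the vertex with the largest key, update the other keys by its row, and repeat. -/
def arrange (n : ℕ) (l : List (ℕ × ℕ × List ℕ)) : List ℕ :=
  Nat.rec (fun _ => []) (fun _ r l => List.rec [] (fun a l _ =>
    let p := pick l a
    p.1.2.1 :: r (p.2.map fun x => ((Nat.mul 3 x.1).add (entry p.1.2.2 x.2.1), x.2))) l) n l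

/-- The vertices in an order that hardly depends on the numbering. -/
def ordering (c : EdgeList) : List ℕ :=
  arrange c.order (List.zipWith (fun v r => (cubeSum r, v, r)) (List.range c.order) c.rows)

def ltEdge (f e : ℕ × ℕ) : Bool :=
  bif e.1.blt f.1 then true else bif e.1.beq f.1 then e.2.blt f.2 else false

def insertEdge (e : ℕ × ℕ) (l : List (ℕ × ℕ)) : List (ℕ × ℕ) :=
  List.rec [e] (fun f l r => bif ltEdge e f then e :: f :: l else f :: r) l

def orient (e : ℕ × ℕ) : ℕ × ℕ := bif e.1.blt e.2 then e else (e.2, e.1)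

def renumber (p : List ℕ) (c : EdgeList) : EdgeList :=
  ⟨c.order, c.edges.recFold [] fun e l => insertEdge (orient (index p e.1, index p e.2)) l⟩

def isNumbering (n : ℕ) (p : List ℕ) : Bool :=
  (List.range n).recFold true fun v r =>
    bif (index p v).blt n then bif (entry p (index p v)).beq v then r else false else false

def normalize (c : EdgeList) : EdgeList :=
  bif isNumbering c.order c.ordering then renumber c.ordering c else c

def beqEdges (l : List (ℕ × ℕ)) : List (ℕ × ℕ) → Bool :=
  l.recFold (fun m => List.rec true (fun _ _ _ => false) m) fun e r m =>
    List.rec false (fun f m _ =>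
      bif e.1.beq f.1 then bif e.2.beq f.2 then r m else false else false) m

def beq (c d : EdgeList) : Bool :=
  bif c.order.beq d.order then beqEdges c.edges d.edges else false

def insertNew (c : EdgeList) (L : List EdgeList) : List EdgeList :=
  bif L.recFold false fun d r => bif c.beq d then true else r then L else c :: L

abbrev addLeaf (c : EdgeList) (w : ℕ) : EdgeList := ⟨c.order + 1, (w, c.order) :: c.edges⟩

abbrev addEdge (c : EdgeList) (u v : ℕ) : EdgeList := ⟨c.order, (u, v) :: c.edges⟩

def leaves (c : EdgeList) : List ℕ :=
  select (fun v => Nat.beq 1 (c.neighbors v).length) (List.range c.order)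

/-- Whether, after adding a leaf at `w`, no other leaf is attached to a vertex of larger degree. -/
def isMaximal (c : EdgeList) (w : ℕ) : Bool :=
  c.leaves.all fun x => x.beq w ||
    (c.neighbors x).all fun y => (c.neighbors y).length.ble (c.neighbors w).length.succ

/-- All ways to add a leaf attached to a vertex of maximal degree, and all ways to add an edge that
leave no leaf. -/
def extensions (c : EdgeList) : List EdgeList :=
  (select c.isMaximal (List.range c.order)).map c.addLeaf ++
    (List.range c.order).flatMap fun v =>
      (select (fun u => c.leaves.all (fun x => x.beq u || x.beq v) && !c.adj u v)
        (List.range v)).map fun u => c.addEdge u v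

/-- Representatives of the connected graphs with `k` edges. -/
def level : ℕ → List EdgeList
  | 0 => [⟨1, []⟩]
  | k + 1 => ((level k).flatMap extensions).foldr (fun c L => insertNew c.normalize L) []

theorem level_eight :
    (((level 8).map invariant).Nodup) ∧ ((level 8).map invariant).length = 227 := by
  decide +kernel

/-! ### Specifications -/

theorem select_eq_filter (p : ℕ → Bool) (l : List ℕ) : select p l = l.filter p := by
  rw [select, List.recFold_eq_foldr]
  induction l with
  | nil => rfl
  | cons a l ih => rw [List.foldr_cons, ih, List.filter_cons]; cases p a <;> rfl

theorem addUp_eq_sum (l : List ℕ) (f : ℕ → ℕ) : addUp l f = (l.map f).sum := by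
  rw [addUp, List.recFold_eq_foldr]
  induction l with
  | nil => rfl
  | cons a l ih => rw [List.foldr_cons, ih, List.map_cons, List.sum_cons]; rfl

theorem entry_eq_getD (l : List ℕ) (i : ℕ) : entry l i = l.getD i 0 := by
  rw [entry, List.recFold_eq_foldr]
  induction l generalizing i with
  | nil => rfl
  | cons a l ih => cases i with
    | zero => rfl
    | succ i => exact ih i

theorem entry_map_range (f : ℕ → ℕ) {n i : ℕ} (h : i < n) :
    entry ((List.range n).map f) i = f i := by
  simp [entry_eq_getD, h]

theorem sum_map_range (n : ℕ) (f : ℕ → ℕ) :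
    ((List.range n).map f).sum = ∑ i : Fin n, f i := Finset.sum_range f

theorem mem_star {c : EdgeList} {i j : ℕ} :
    j ∈ c.star i ↔ (i, j) ∈ c.edges ∨ (j, i) ∈ c.edges := by
  rw [star, List.recFold_eq_foldr]
  induction c.edges with
  | nil => simp
  | cons e l ih =>
    obtain ⟨a, b⟩ := e
    simp only [List.foldr_cons, List.mem_cons, Prod.mk.injEq]
    by_cases h1 : a = i
    · subst h1
      simp [ih]
      grind
    · have h1' : a.beq i = false := by rwa [← Bool.not_eq_true, Nat.beq_eq]
      by_cases h2 : b = i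
      · subst h2
        simp [ih, h1']
        grind
      · have h2' : b.beq i = false := by rwa [← Bool.not_eq_true, Nat.beq_eq]
        simp [ih, h1', h2']
        grind

theorem adj_iff {c : EdgeList} {i j : ℕ} :
    c.adj i j = true ↔ (i, j) ∈ c.edges ∨ (j, i) ∈ c.edges := by
  rw [← mem_star, adj, List.recFold_eq_foldr]
  induction c.star i with
  | nil => simp
  | cons k l ih =>
    rw [List.foldr_cons, List.mem_cons, Bool.cond_eq_ite]
    by_cases h : k = j
    · simp [h]
    · have h' : k.beq j = false := by rwa [← Bool.not_eq_true, Nat.beq_eq]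
      simpa [h', Ne.symm h] using ih

theorem neighbors_eq (c : EdgeList) (v : ℕ) :
    c.neighbors v = (List.range c.order).filter (c.adj v) := select_eq_filter _ _

theorem digits_sum (b : ℕ) (n : ℕ) (f : ℕ → ℕ) (hf : ∀ i < n, f i < b) :
    digits b n (∑ i ∈ Finset.range n, f i * b ^ i) = (List.range n).map f := by
  induction n generalizing f with
  | zero => rfl
  | succ n ih =>
    have h0 := hf 0 n.succ_pos
    have h1 : ∑ i ∈ Finset.range (n + 1), f i * b ^ i =
        f 0 + b * ∑ i ∈ Finset.range n, f (i + 1) * b ^ i := by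
      rw [Finset.sum_range_succ', Finset.mul_sum, add_comm]
      simp [pow_succ]
      exact Finset.sum_congr rfl fun _ _ => by ring
    have h2 : (f 0 + b * ∑ i ∈ Finset.range n, f (i + 1) * b ^ i) % b = f 0 := by
      rw [Nat.add_mul_mod_self_left, Nat.mod_eq_of_lt h0]
    have h3 : (f 0 + b * ∑ i ∈ Finset.range n, f (i + 1) * b ^ i) / b =
        ∑ i ∈ Finset.range n, f (i + 1) * b ^ i := by
      rw [Nat.add_mul_div_left _ _ (by omega), Nat.div_eq_of_lt h0, zero_add]
    have h4 := ih (fun i => f (i + 1)) fun i hi => hf _ (by omega)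
    rw [h1, List.range_succ_eq_map, List.map_cons, List.map_map]
    change _ % b :: digits b n (_ / b) = _
    rw [h2, h3, h4]
    rfl

/-! ### The graph of an edge list -/

/-- The graph described by an edge list. -/
def graph (c : EdgeList) : SimpleGraph (Fin c.order) :=
  SimpleGraph.fromRel fun i j => ((i : ℕ), (j : ℕ)) ∈ c.edges

/-- The edges join distinct vertices smaller than the order. -/
def Valid (c : EdgeList) : Prop := ∀ e ∈ c.edges, e.1 < c.order ∧ e.2 < c.order ∧ e.1 ≠ e.2

variable {c : EdgeList}

theorem Valid.graph_adj (hc : c.Valid) {i j : Fin c.order} :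
    c.graph.Adj i j ↔ ((i : ℕ), (j : ℕ)) ∈ c.edges ∨ ((j : ℕ), (i : ℕ)) ∈ c.edges := by
  rw [graph, SimpleGraph.fromRel_adj, and_iff_right_iff_imp]
  rintro (h | h) rfl <;> exact (hc _ h).2.2 rfl

theorem Valid.adj_iff (hc : c.Valid) {i j : Fin c.order} :
    c.adj i j = true ↔ c.graph.Adj i j := by
  rw [hc.graph_adj, EdgeList.adj_iff]

open Classical in
theorem Valid.sum_neighbors (hc : c.Valid) (v : Fin c.order) (f : ℕ → ℕ) :
    addUp (c.neighbors v) f = ∑ w : Fin c.order, if c.graph.Adj v w then f w else 0 := by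
  have h : ∀ l : List ℕ, ((l.filter (c.adj v)).map f).sum =
      (l.map fun w => if c.adj v w = true then f w else 0).sum := fun l => by
    induction l with
    | nil => rfl
    | cons a l ih => by_cases ha : c.adj v a = true <;> simp [ha, ih]
  rw [addUp_eq_sum, neighbors_eq, h, sum_map_range]
  simp only [hc.adj_iff]

theorem Valid.step_eq (hc : c.Valid) (t : ℕ) (g h : ℕ → ℕ) (b : Fin c.order → ℕ)
    (hg : ∀ i : Fin c.order, g i = ∑ u, c.graph.walkCount u t i * b u)
    (hh : ∀ i : Fin c.order, h i = ∑ u, c.graph.walkCount u (t + 1) i * b u) :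
    step ((List.range c.order).map fun v => (v, c.neighbors v)) ((List.range c.order).map g) =
      (List.range c.order).map h := by
  classical
  rw [step, List.map_map]
  refine List.map_congr_left fun v hv => ?_
  lift v to Fin c.order using List.mem_range.1 hv
  simp only [Function.comp_apply]
  rw [hc.sum_neighbors, hh]
  simp only [SimpleGraph.walkCount, Finset.sum_mul]
  rw [Finset.sum_comm]
  refine Finset.sum_congr rfl fun w _ => ?_
  split_ifs
  · change entry _ _ + entry _ _ = _
    rw [entry_map_range _ v.2, entry_map_range _ w.2, hg, hg, ← Finset.sum_add_distrib]
    exact Finset.sum_congr rfl fun u _ => (add_mul _ _ _).symm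
  · simp

/-- `walkCount` on vertices given as natural numbers. -/
def walkEntry (c : EdgeList) (t v u : ℕ) : ℕ :=
  if h : u < c.order ∧ v < c.order then c.graph.walkCount ⟨u, h.1⟩ t ⟨v, h.2⟩ else 0

theorem walkEntry_coe (t : ℕ) (v u : Fin c.order) :
    c.walkEntry t v u = c.graph.walkCount u t v := dif_pos ⟨u.2, v.2⟩

theorem Valid.step_walkEntry (hc : c.Valid) (t b : ℕ) :
    step ((List.range c.order).map fun v => (v, c.neighbors v))
      ((List.range c.order).map fun v => ∑ u ∈ Finset.range c.order, c.walkEntry t v u * b ^ u) =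
      (List.range c.order).map fun v =>
        ∑ u ∈ Finset.range c.order, c.walkEntry (t + 1) v u * b ^ u := by
  refine hc.step_eq t _ _ (fun u => b ^ (u : ℕ)) ?_ ?_ <;>
  · intro i
    simp only [Finset.sum_range, walkEntry_coe]

theorem Valid.rows_eq (hc : c.Valid) :
    c.rows = (List.range c.order).map fun v => (List.range c.order).map (c.walkEntry 4 v) := by
  have h : (List.range c.order).map (fun v => c.base.pow v) =
      (List.range c.order).map fun v =>
        ∑ u ∈ Finset.range c.order, c.walkEntry 0 v u * c.base ^ u := by
    refine List.map_congr_left fun v hv => ?_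
    lift v to Fin c.order using List.mem_range.1 hv
    simp [Finset.sum_range, walkEntry_coe, SimpleGraph.walkCount]
  simp only [rows]
  rw [h, hc.step_walkEntry, hc.step_walkEntry, hc.step_walkEntry, hc.step_walkEntry, List.map_map]
  refine List.map_congr_left fun v hv => digits_sum _ _ _ fun u hu => ?_
  lift v to Fin c.order using List.mem_range.1 hv
  lift u to Fin c.order using hu
  rw [walkEntry_coe, base, Nat.lt_succ_iff]
  simpa using c.graph.walkCount_le u 4 v

theorem Valid.invariant_eq (hc : c.Valid) : c.invariant = c.graph.walkInvariant := by
  rw [invariant, addUp_eq_sum, List.map_id, hc.rows_eq, List.map_map, sum_map_range]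
  refine Finset.sum_congr rfl fun v _ => ?_
  rw [Function.comp_apply, cubeSum, addUp_eq_sum, List.map_map, sum_map_range]
  simp [walkEntry_coe]

/-! ### Normalization and removal of duplicates -/

theorem mem_insertEdge {e f : ℕ × ℕ} {l : List (ℕ × ℕ)} :
    f ∈ insertEdge e l ↔ f = e ∨ f ∈ l := by
  induction l with
  | nil => simp [insertEdge]
  | cons a l ih =>
    change f ∈ (bif ltEdge e a then e :: a :: l else a :: insertEdge e l) ↔ _
    cases ltEdge e a <;> simp [ih]
    tauto

theorem mem_edges_renumber {p : List ℕ} {f : ℕ × ℕ} :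
    f ∈ (renumber p c).edges ↔ ∃ e ∈ c.edges, f = orient (index p e.1, index p e.2) := by
  rw [renumber, List.recFold_eq_foldr]
  dsimp only
  induction c.edges with
  | nil => simp
  | cons a l ih => simp [mem_insertEdge, ih]

theorem orient_eq_or (e : ℕ × ℕ) : orient e = e ∨ orient e = (e.2, e.1) := by
  rw [orient]
  cases e.1.blt e.2 <;> simp

theorem mem_edges_renumber_or {p : List ℕ} {i j : ℕ} :
    (i, j) ∈ (renumber p c).edges ∨ (j, i) ∈ (renumber p c).edges ↔ ∃ e ∈ c.edges,
      i = index p e.1 ∧ j = index p e.2 ∨ i = index p e.2 ∧ j = index p e.1 := by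
  rw [mem_edges_renumber, mem_edges_renumber, ← exists_or]
  refine exists_congr fun e => ?_
  rw [← and_or_left]
  refine and_congr_right fun _ => ?_
  rcases orient_eq_or (index p e.1, index p e.2) with h | h <;> rw [h] <;>
    simp only [Prod.mk.injEq] <;> tauto

theorem index_of_isNumbering {n : ℕ} {p : List ℕ} (h : isNumbering n p = true) {v : ℕ}
    (hv : v < n) : index p v < n ∧ entry p (index p v) = v := by
  have key : ∀ l : List ℕ, l.recFold true (fun v r => bif (index p v).blt n then
      bif (entry p (index p v)).beq v then r else false else false) = true →
      ∀ v ∈ l, index p v < n ∧ entry p (index p v) = v := fun l => by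
    rw [List.recFold_eq_foldr]
    induction l with
    | nil => simp
    | cons a l ih =>
      rw [List.foldr_cons, List.forall_mem_cons, Bool.cond_eq_ite, Bool.cond_eq_ite]
      split_ifs with h1 h2
      · exact fun h => ⟨⟨by simpa [Nat.blt_eq] using h1, by simpa using h2⟩, ih h⟩
      · simp
      · simp
  exact key _ h v (List.mem_range.2 hv)

theorem Valid.renumber_iso (hc : c.Valid) {p : List ℕ} (h : isNumbering c.order p = true) :
    (renumber p c).Valid ∧ Nonempty (c.graph ≃g (renumber p c).graph) := by
  have hp {v : ℕ} (hv : v < c.order) := index_of_isNumbering h hv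
  have hv : (renumber p c).Valid := by
    intro f hf
    obtain ⟨e, he, rfl⟩ := mem_edges_renumber.1 hf
    obtain ⟨h1, h2, h3⟩ := hc e he
    have h4 : index p e.1 ≠ index p e.2 := fun h4 => h3 (by
      rw [← (hp h1).2, ← (hp h2).2, h4])
    rcases orient_eq_or (index p e.1, index p e.2) with h | h <;> rw [h]
    · exact ⟨(hp h1).1, (hp h2).1, h4⟩
    · exact ⟨(hp h2).1, (hp h1).1, h4.symm⟩
  refine ⟨hv, ?_⟩
  let σ : Fin c.order → Fin (renumber p c).order := fun v => ⟨index p v, (hp v.2).1⟩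
  have hσ : Function.Injective σ := fun v w hvw => Fin.ext (by
    rw [← (hp v.2).2, ← (hp w.2).2, Fin.mk.inj_iff.1 hvw])
  have hσ' : Function.Bijective σ := (Fintype.bijective_iff_injective_and_card σ).2 ⟨hσ, rfl⟩
  have inj {v w : ℕ} (h1 : v < c.order) (h2 : w < c.order) (h : index p v = index p w) :
      v = w := by rw [← (hp h1).2, ← (hp h2).2, h]
  refine ⟨⟨Equiv.ofBijective σ hσ', fun {v w} => ?_⟩⟩
  rw [hv.graph_adj, hc.graph_adj, mem_edges_renumber_or]
  simp only [Equiv.ofBijective_apply, σ]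
  constructor
  · rintro ⟨e, he, ⟨h1, h2⟩ | ⟨h1, h2⟩⟩ <;> obtain ⟨h3, h4, -⟩ := hc e he
    · rw [inj v.2 h3 h1, inj w.2 h4 h2]
      exact Or.inl he
    · rw [inj v.2 h4 h1, inj w.2 h3 h2]
      exact Or.inr he
  · rintro (h | h)
    · exact ⟨_, h, Or.inl ⟨rfl, rfl⟩⟩
    · exact ⟨_, h, Or.inr ⟨rfl, rfl⟩⟩

theorem Valid.normalize_iso (hc : c.Valid) :
    c.normalize.Valid ∧ Nonempty (c.graph ≃g c.normalize.graph) := by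
  have h : c.normalize = bif isNumbering c.order c.ordering then renumber c.ordering c else c := rfl
  cases hn : isNumbering c.order c.ordering with
  | true =>
    rw [hn, cond_true] at h
    rw [h]
    exact hc.renumber_iso hn
  | false =>
    rw [hn, cond_false] at h
    rw [h]
    exact ⟨hc, ⟨SimpleGraph.Iso.refl⟩⟩

theorem eq_of_beq {d : EdgeList} (h : c.beq d = true) : c = d := by
  have key : ∀ l m : List (ℕ × ℕ), beqEdges l m = true → l = m := fun l => by
    induction l with
    | nil => intro m hm; cases m with
      | nil => rfl
      | cons => exact absurd hm Bool.false_ne_true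
    | cons e l ih => intro m hm; cases m with
      | nil => exact absurd hm Bool.false_ne_true
      | cons f m =>
        change (bif e.1.beq f.1 then bif e.2.beq f.2 then beqEdges l m else false else false) = true
          at hm
        simp only [Bool.cond_eq_ite, Nat.beq_eq] at hm
        split_ifs at hm with h1 h2
        rw [ih m hm, Prod.ext h1 h2]
  obtain ⟨n, l⟩ := c
  obtain ⟨m, l'⟩ := d
  simp only [beq, Bool.cond_eq_ite, Nat.beq_eq] at h
  split_ifs at h with h1
  rw [h1, key _ _ h]

theorem mem_insertNew {d : EdgeList} {L : List EdgeList} :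
    d ∈ insertNew c L ↔ d = c ∨ d ∈ L := by
  have key : (L.recFold false fun d r => bif c.beq d then true else r) = true → c ∈ L := by
    rw [List.recFold_eq_foldr]
    induction L with
    | nil => simp
    | cons a L ih =>
      rw [List.foldr_cons, Bool.cond_eq_ite]
      split_ifs with h
      · simp [eq_of_beq h]
      · exact fun h => List.mem_cons_of_mem _ (ih h)
  rw [insertNew, Bool.cond_eq_ite]
  split_ifs with h
  · exact ⟨Or.inr, fun h' => h'.elim (fun h' => h' ▸ key h) id⟩
  · exact List.mem_cons

theorem mem_level_succ {k : ℕ} :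
    c ∈ level (k + 1) ↔ ∃ d ∈ level k, ∃ x ∈ d.extensions, c = x.normalize := by
  have key : ∀ L : List EdgeList, c ∈ L.foldr (fun c L => insertNew c.normalize L) [] ↔
      ∃ x ∈ L, c = x.normalize := fun L => by
    induction L with
    | nil => simp
    | cons a L ih => simp [mem_insertNew, ih]
  rw [level, key]
  simp [List.mem_flatMap]
  grind
/-! ### The levels consist of all connected graphs with a given number of edges -/

theorem mem_leaves {v : ℕ} : v ∈ c.leaves ↔ v < c.order ∧ (c.neighbors v).length = 1 := by
  rw [leaves, select_eq_filter, List.mem_filter, List.mem_range, Nat.beq_eq, eq_comm (a := 1)]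

theorem Valid.length_neighbors (hc : c.Valid) (v : Fin c.order)
    [Fintype (c.graph.neighborSet v)] : (c.neighbors v).length = c.graph.degree v := by
  classical
  have h := c.graph.degree_eq_sum_if_adj (R := ℕ) v
  rw [← hc.sum_neighbors v fun _ => 1, addUp_eq_sum] at h
  rw [List.map_const', List.sum_replicate, smul_eq_mul, mul_one, Nat.cast_id] at h
  convert h.symm

theorem mem_extensions {x : EdgeList} : x ∈ c.extensions ↔
    (∃ w < c.order, c.isMaximal w = true ∧ x = c.addLeaf w) ∨ ∃ v < c.order, ∃ u < v,
      (∀ y ∈ c.leaves, y = u ∨ y = v) ∧ c.adj u v = false ∧ x = c.addEdge u v := by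
  simp only [extensions, select_eq_filter, List.mem_append, List.mem_map, List.mem_flatMap,
    List.mem_filter, List.mem_range, Bool.and_eq_true, List.all_eq_true, Bool.or_eq_true, Nat.beq_eq,
    Bool.not_eq_true', and_assoc, eq_comm (b := x)]

theorem Valid.addLeaf (hc : c.Valid) {w : ℕ} (hw : w < c.order) : (c.addLeaf w).Valid := by
  rintro e (_ | ⟨_, he⟩)
  · exact ⟨hw.trans c.order.lt_succ_self, c.order.lt_succ_self, hw.ne⟩
  · obtain ⟨h1, h2, h3⟩ := hc e he
    exact ⟨h1.trans c.order.lt_succ_self, h2.trans c.order.lt_succ_self, h3⟩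

theorem Valid.addEdge (hc : c.Valid) {u v : ℕ} (hu : u < v) (hv : v < c.order) :
    (c.addEdge u v).Valid := by
  rintro e (_ | ⟨_, he⟩)
  · exact ⟨hu.trans hv, hv, hu.ne⟩
  · exact hc e he

theorem Valid.isLeafAt_addLeaf (hc : c.Valid) (w : Fin c.order) :
    (c.addLeaf w).graph.IsLeafAt (Fin.last c.order) w.castSucc := by
  intro x
  rw [(hc.addLeaf w.2).graph_adj, Fin.ext_iff]
  simp only [EdgeList.addLeaf, List.mem_cons, Prod.mk.injEq, Fin.val_last, Fin.val_castSucc]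
  have h1 : ∀ i, (c.order, i) ∉ c.edges := fun i h => (hc _ h).1.ne rfl
  have h2 : ∀ i, (i, c.order) ∉ c.edges := fun i h => (hc _ h).2.1.ne rfl
  have h3 := w.2
  simp only [h1, h2, or_false, and_true]
  omega

/-- Deleting the leaf from `c.addLeaf w`. -/
def Valid.isoAddLeaf (hc : c.Valid) (w : Fin c.order) :
    c.graph ≃g (c.addLeaf w).graph.induce {(Fin.last c.order : Fin (c.order + 1))}ᶜ where
  toEquiv := finSuccAboveEquiv (Fin.last c.order)
  map_rel_iff' {i j} := by
    change (c.addLeaf w).graph.Adj ((Fin.last c.order).succAbove i)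
      ((Fin.last c.order).succAbove j) ↔ _
    rw [(hc.addLeaf w.2).graph_adj, hc.graph_adj]
    have hi := i.2
    have hj := j.2
    simp only [EdgeList.addLeaf, List.mem_cons, Prod.mk.injEq, Fin.succAbove_last,
      Fin.val_castSucc, hi.ne, hj.ne, and_false, false_or]

theorem Valid.graph_addEdge_adj (hc : c.Valid) {u v : Fin c.order} (huv : u < v)
    {i j : Fin c.order} :
    (c.addEdge u v).graph.Adj i j ↔ s(i, j) = s(u, v) ∨ c.graph.Adj i j := by
  rw [(hc.addEdge huv v.2).graph_adj, hc.graph_adj]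
  simp only [EdgeList.addEdge, List.mem_cons, Prod.mk.injEq, Sym2.eq_iff, Fin.ext_iff]
  tauto

theorem Valid.deleteEdges_addEdge (hc : c.Valid) {u v : Fin c.order} (huv : u < v)
    (h : ¬c.graph.Adj u v) : (c.addEdge u v).graph.deleteEdges {s(u, v)} = c.graph := by
  ext i j
  rw [SimpleGraph.deleteEdges_adj]
  refine (and_congr_left' (hc.graph_addEdge_adj huv)).trans ?_
  rw [Set.mem_singleton_iff]
  by_cases h1 : s(i, j) = s(u, v)
  · have h2 : ¬c.graph.Adj i j := by
      rw [← SimpleGraph.mem_edgeSet, h1]; exact h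
    tauto
  · tauto

theorem sound_of_mem_level {k : ℕ} (h : c ∈ level k) :
    c.Valid ∧ c.graph.Connected ∧ c.graph.edgeSet.ncard = k := by
  induction k generalizing c with
  | zero =>
    obtain rfl := List.mem_singleton.1 h
    have hb : (EdgeList.mk 1 []).graph = ⊥ := by
      ext i j
      simp [graph]
    refine ⟨by simp [Valid], ?_, by rw [hb]; simp⟩
    have : Subsingleton (Fin (EdgeList.mk 1 []).order) := inferInstanceAs (Subsingleton (Fin 1))
    have : Nonempty (Fin (EdgeList.mk 1 []).order) := inferInstanceAs (Nonempty (Fin 1))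
    exact SimpleGraph.Connected.of_subsingleton
  | succ k ih =>
    obtain ⟨d, hd, x, hx, rfl⟩ := mem_level_succ.1 h
    obtain ⟨hdv, hdc, hdk⟩ := ih hd
    suffices hs : x.Valid ∧ x.graph.Connected ∧ x.graph.edgeSet.ncard = k + 1 by
      obtain ⟨hv, ⟨e⟩⟩ := hs.1.normalize_iso
      exact ⟨hv, e.connected_iff.1 hs.2.1, e.ncard_edgeSet ▸ hs.2.2⟩
    rcases mem_extensions.1 hx with ⟨w, hw, -, rfl⟩ | ⟨v, hv, u, hu, -, huv, rfl⟩
    · lift w to Fin d.order using hw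
      have hl := hdv.isLeafAt_addLeaf w
      have e := hdv.isoAddLeaf w
      refine ⟨hdv.addLeaf w.2, hl.connected (e.connected_iff.1 hdc), ?_⟩
      rw [hl.ncard_edgeSet, ← hdk, e.ncard_edgeSet]
    · have hu' := hu.trans hv
      lift v to Fin d.order using hv
      lift u to Fin d.order using hu'
      have hn : ¬d.graph.Adj u v := by rw [← hdv.adj_iff, huv]; exact Bool.false_ne_true
      have hde := hdv.deleteEdges_addEdge hu hn
      refine ⟨hdv.addEdge hu v.2, ?_, ?_⟩
      · rw [← hde] at hdc
        exact hdc.mono (SimpleGraph.deleteEdges_le _)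
      · rw [← hdk, ← hde]
        exact SimpleGraph.ncard_edgeSet_deleteEdges_singleton
          ((hdv.graph_addEdge_adj hu).2 (Or.inl rfl))

theorem Valid.exists_isLeafAt (hc : c.Valid) {v : Fin c.order} (h : (v : ℕ) ∈ c.leaves) :
    ∃ a, c.graph.IsLeafAt v a := by
  obtain ⟨a, ha⟩ := List.length_eq_one_iff.1 (mem_leaves.1 h).2
  rw [neighbors_eq] at ha
  have h1 : ∀ x : Fin c.order, c.graph.Adj v x ↔ (x : ℕ) = a := fun x => by
    rw [← hc.adj_iff, ← List.mem_singleton (b := a), ← ha, List.mem_filter, List.mem_range]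
    exact (and_iff_right x.2).symm
  have h2 : a ∈ [a] := List.mem_singleton_self a
  rw [← ha, List.mem_filter, List.mem_range] at h2
  exact ⟨⟨a, h2.1⟩, fun x => (h1 x).trans (by rw [Fin.ext_iff])⟩

theorem exists_mem_level_succ {k : ℕ} {d x : EdgeList} (hd : d ∈ level k) (hx : x ∈ d.extensions)
    (hv : x.Valid) {V : Type*} {G : SimpleGraph V} (e : G ≃g x.graph) :
    ∃ c ∈ level (k + 1), Nonempty (G ≃g c.graph) := by
  obtain ⟨-, ⟨e'⟩⟩ := hv.normalize_iso
  exact ⟨_, mem_level_succ.2 ⟨d, hd, x, hx, rfl⟩, ⟨e.trans e'⟩⟩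

open Classical in
theorem exists_mem_level {k : ℕ} {V : Type*} [Finite V] {G : SimpleGraph V} (hG : G.Connected)
    (hk : G.edgeSet.ncard = k) : ∃ c ∈ level k, Nonempty (G ≃g c.graph) := by
  induction k generalizing V with
  | zero =>
    have hb : G = ⊥ := by
      rwa [Set.ncard_eq_zero, SimpleGraph.edgeSet_eq_empty] at hk
    refine ⟨_, List.mem_singleton_self _, ?_⟩
    have := hG.nonempty
    have : Subsingleton V := by
      refine ⟨fun a b => ?_⟩
      have := hG.preconnected a b
      rwa [hb, SimpleGraph.reachable_bot] at this
    obtain ⟨f⟩ : Nonempty (V ≃ Fin 1) := by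
      have := uniqueOfSubsingleton (Classical.arbitrary V)
      exact ⟨Equiv.ofUnique V (Fin 1)⟩
    refine ⟨⟨f, fun {i j} => ?_⟩⟩
    simp [hb, graph]
  | succ k ih =>
    have hne : G.edgeSet.Nonempty := Set.nonempty_of_ncard_ne_zero (by omega)
    by_cases hl : ∃ v a, G.IsLeafAt v a
    · have := Fintype.ofFinite V
      obtain ⟨v, a, hva, hmax⟩ := SimpleGraph.exists_isLeafAt_forall_degree_le hl
      obtain ⟨d, hd, ⟨e⟩⟩ := ih (hva.connected_induce hG) (by have := hva.ncard_edgeSet; omega)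
      have hdv := (sound_of_mem_level hd).1
      set w := e ⟨a, hva.ne⟩ with hwa
      have hw : d.isMaximal w = true := by
        simp only [isMaximal, List.all_eq_true, Bool.or_eq_true, Nat.beq_eq, Nat.ble_eq]
        intro x hx
        have hxn := (mem_leaves.1 hx).1
        lift x to Fin d.order using hxn
        rw [or_iff_not_imp_left]
        intro hxw y hy
        rw [neighbors_eq, List.mem_filter, List.mem_range] at hy
        obtain ⟨hyn, hy⟩ := hy
        lift y to Fin d.order using hyn
        obtain ⟨b, hb⟩ := hdv.exists_isLeafAt hx
        obtain rfl := (hb y).1 (hdv.adj_iff.1 hy)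
        obtain ⟨x, rfl⟩ := e.surjective x
        obtain ⟨y, rfl⟩ := e.surjective y
        have h1 : (G.induce {v}ᶜ).IsLeafAt x y := fun z => by
          rw [← e.map_adj_iff, hb, e.injective.eq_iff]
        have h2 := hmax _ _ (hva.of_induce h1 fun h => hxw (congrArg (fun z => (e z : ℕ))
          (Subtype.ext h)))
        have h3 := SimpleGraph.degree_induce_compl_singleton G y
        have h4 := SimpleGraph.degree_induce_compl_singleton G ⟨a, hva.ne⟩
        rw [hdv.length_neighbors, hdv.length_neighbors, e.degree_eq, hwa, e.degree_eq]
        dsimp only at h4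
        split_ifs at h3 h4 <;> omega
      obtain ⟨e'⟩ := hva.nonempty_iso (hdv.isLeafAt_addLeaf w) (e.trans (hdv.isoAddLeaf w)) (by
        exact Fin.succAbove_last_apply w)
      exact exists_mem_level_succ hd (mem_extensions.2 (Or.inl ⟨w, w.2, hw, rfl⟩))
        (hdv.addLeaf w.2) e'
    · obtain ⟨u, v, huv, hb⟩ := (hG.exists_isLeafAt_or_not_isBridge hne).resolve_left hl
      obtain ⟨G', hG'⟩ : ∃ G', G' = G.deleteEdges {s(u, v)} := ⟨_, rfl⟩
      obtain ⟨d, hd, ⟨e⟩⟩ := ih (G := G') (hG' ▸ hG.connected_delete_edge_of_not_isBridge hb)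
        (by have := SimpleGraph.ncard_edgeSet_deleteEdges_singleton huv; subst hG'; omega)
      have hdv := (sound_of_mem_level hd).1
      wlog hlt : e u < e v generalizing u v
      · have hs : s(v, u) = s(u, v) := Sym2.eq_swap
        exact this v u huv.symm (hs ▸ hb) (hs ▸ hG')
          (lt_of_le_of_ne (not_lt.1 hlt) (e.injective.ne huv.ne'))
      subst hG'
      have hn : ¬d.graph.Adj (e u) (e v) := by
        rw [e.map_adj_iff, SimpleGraph.deleteEdges_adj]
        simp
      obtain ⟨e'⟩ := SimpleGraph.nonempty_iso_of_deleteEdges huv e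
        ((hdv.graph_addEdge_adj hlt).2 (Or.inl rfl)) (hdv.deleteEdges_addEdge hlt hn)
      refine exists_mem_level_succ hd (mem_extensions.2 (Or.inr
        ⟨e v, (e v).2, e u, hlt, ?_, ?_, rfl⟩)) (hdv.addEdge hlt (e v).2) e'
      · intro y hy
        have hyn := (mem_leaves.1 hy).1
        lift y to Fin d.order using hyn
        obtain ⟨a, ha⟩ := hdv.exists_isLeafAt hy
        by_contra! hcon
        refine hl ⟨e.symm y, e.symm a, fun x => ?_⟩
        have h1 : e.symm y ≠ u := fun h => hcon.1 (congrArg _ (e.toEquiv.symm_apply_eq.1 h))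
        have h2 : e.symm y ≠ v := fun h => hcon.2 (congrArg _ (e.toEquiv.symm_apply_eq.1 h))
        have h3 : s(e.symm y, x) ∉ ({s(u, v)} : Set (Sym2 V)) := by
          rw [Set.mem_singleton_iff, Sym2.eq_iff]
          tauto
        have h4 := e.map_adj_iff (v := e.symm y) (w := x)
        rw [e.apply_symm_apply, ha, SimpleGraph.deleteEdges_adj, and_iff_left h3] at h4
        exact h4.symm.trans e.toEquiv.eq_symm_apply.symm
      · rw [← Bool.not_eq_true, hdv.adj_iff]
        exact hn

theorem eq_of_walkInvariant_eq {d : EdgeList} (hc : c ∈ level 8) (hd : d ∈ level 8)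
    (h : c.graph.walkInvariant = d.graph.walkInvariant) : c = d :=
  List.inj_on_of_nodup_map level_eight.1 hc hd (by
    rw [(sound_of_mem_level hc).1.invariant_eq, (sound_of_mem_level hd).1.invariant_eq, h])

end

end EdgeList

namespace Graphlet

variable {k : ℕ}

theorem exists_mem_level (G : Graphlet k) :
    ∃ c ∈ EdgeList.level k, Nonempty (G.1.2 ≃g c.graph) :=
  EdgeList.exists_mem_level G.2.1 G.2.2.2

theorem graphletIso_iff_walkInvariant_eq {G H : Graphlet 8} :
    graphletIso G H ↔ G.1.2.walkInvariant = H.1.2.walkInvariant := by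
  refine ⟨fun ⟨e⟩ => e.walkInvariant_eq, fun h => ?_⟩
  obtain ⟨c, hc, ⟨e⟩⟩ := G.exists_mem_level
  obtain ⟨d, hd, ⟨f⟩⟩ := H.exists_mem_level
  obtain rfl : c = d := EdgeList.eq_of_walkInvariant_eq hc hd (by
    rw [← e.walkInvariant_eq, ← f.walkInvariant_eq, h])
  exact ⟨e.trans f.symm⟩

/-- The graphlet given by a member of a level. -/
def ofMemLevel {c : EdgeList} (hc : c ∈ EdgeList.level (k + 1)) : Graphlet (k + 1) := by
  refine ⟨⟨c.order, c.graph⟩, (EdgeList.sound_of_mem_level hc).2.1, fun v => ?_,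
    (EdgeList.sound_of_mem_level hc).2.2⟩
  obtain ⟨-, hcon, hcard⟩ := EdgeList.sound_of_mem_level hc
  obtain ⟨⟨x, y⟩, hxy⟩ := Set.nonempty_of_ncard_ne_zero (hcard.trans_ne k.succ_ne_zero)
  have : Nontrivial (Fin c.order) := ⟨x, y, (c.graph.mem_edgeSet.1 hxy).ne⟩
  exact hcon.preconnected.exists_adj_of_nontrivial v

theorem range_walkInvariant : Set.range (fun G : Graphlet 8 => G.1.2.walkInvariant) =
    ((EdgeList.level 8).map EdgeList.invariant).toFinset := by
  ext x
  rw [Finset.mem_coe, List.mem_toFinset, List.mem_map, Set.mem_range]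
  constructor
  · rintro ⟨G, rfl⟩
    obtain ⟨c, hc, ⟨e⟩⟩ := G.exists_mem_level
    exact ⟨c, hc, by rw [(EdgeList.sound_of_mem_level hc).1.invariant_eq, e.walkInvariant_eq]⟩
  · rintro ⟨c, hc, rfl⟩
    exact ⟨ofMemLevel hc, (EdgeList.sound_of_mem_level hc).1.invariant_eq.symm⟩

end Graphlet

/-- The number of isomorphism classes of finite connected simple graphs with no
isolated vertices having exactly 8 edges is 227. -/
theorem graphlet_count_8 :
    Nat.card (Quot (@graphletIso 8)) = 227 := by
  let f : Quot (@graphletIso 8) → ℕ := Quot.lift (fun G => G.1.2.walkInvariant)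
    fun _ _ => Graphlet.graphletIso_iff_walkInvariant_eq.1
  have hf : Function.Injective f := by
    rintro ⟨G⟩ ⟨H⟩ h
    exact Quot.sound (Graphlet.graphletIso_iff_walkInvariant_eq.2 h)
  have hr : Set.range f = ((EdgeList.level 8).map EdgeList.invariant).toFinset :=
    (Set.range_quot_lift _).trans Graphlet.range_walkInvariant
  rw [Nat.card_congr (Equiv.ofInjective f hf), Nat.card_coe_set_eq, hr, Set.ncard_coe_finset,
    List.toFinset_card_of_nodup EdgeList.level_eight.1, EdgeList.level_eight.2]
end
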